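/- Let q be a prime power. There exists a primitive 2-normal element in F_{q^5} over F_q if and only if q ≡ 0, 1 or −1 (mod 5). -/

import Mathlib

open Polynomial

noncomputable section

/-- An element of a finite field is *primitive* if it generates the cyclic multiplicative
group, i.e. its multiplicative order is `card E - 1`. -/
def IsPrimitiveElem {E : Type*} [Field E] [Fintype E] (α : E) : Prop :=
  orderOf α = Fintype.card E - 1

/-- The polynomial `g_α(x) = Σ_{i=0}^{n-1} α^{q^i} x^{n-1-i} ∈ F_{q^n}[x]`. -/
def gPoly {E : Type*} [Field E] (q n : ℕ) (α : E) : Polynomial E :=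
  ∑ i ∈ Finset.range n, C (α ^ q ^ i) * X ^ (n - 1 - i)

/-- `α ∈ F_{q^n}` is `k`-normal over `F_q` if `gcd(x^n - 1, g_α(x))` in `F_{q^n}[x]`
has degree `k`. -/
def IsKNormal {E : Type*} [Field E] (q n k : ℕ) (α : E) : Prop :=
  (@EuclideanDomain.gcd (Polynomial E) _ (Classical.decEq _)
    ((X : Polynomial E) ^ n - 1) (gPoly q n α)).natDegree = k

section Counting

variable {F E : Type*} [Field F] [Fintype F] [Field E] [Fintype E] [Algebra F E]

open Classical in
theorem card_trace_orthogonal (h5 : Module.finrank F E = 5) (U : Submodule F E) :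
    (Finset.univ.filter fun u : E => ∀ x ∈ U, Algebra.trace F E (x * u) = 0).card =
      Fintype.card F ^ (5 - Module.finrank F U) := by
  have h := LinearMap.BilinForm.finrank_orthogonal (traceForm_nondegenerate F E) U
  rw [h5] at h
  rw [← h, ← Module.card_eq_pow_finrank, Fintype.card_subtype]
  congr 1
  ext u
  simp [LinearMap.BilinForm.mem_orthogonal_iff]

open Classical in
theorem card_trace_orthogonal_singleton (h5 : Module.finrank F E = 5) {x : E} (hx : x ≠ 0) :
    (Finset.univ.filter fun u : E => Algebra.trace F E (x * u) = 0).card =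
      Fintype.card F ^ 4 := by
  have h := card_trace_orthogonal h5 (Submodule.span F {x})
  rw [finrank_span_singleton hx] at h
  rw [← h]
  congr 1
  ext u
  simp only [Finset.mem_filter, Finset.mem_univ, true_and, Submodule.mem_span_singleton]
  constructor
  · rintro h _ ⟨c, rfl⟩
    simp [h]
  · intro h
    exact h x ⟨1, one_smul _ _⟩

open Classical in
theorem card_trace_orthogonal_pair (h5 : Module.finrank F E = 5) {x y : E} (hx : x ≠ 0)
    (hy : y ∉ Submodule.span F {x}) :
    (Finset.univ.filter fun u : E => Algebra.trace F E (x * u) = 0 ∧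
      Algebra.trace F E (y * u) = 0).card = Fintype.card F ^ 3 := by
  have h := card_trace_orthogonal h5 (Submodule.span F {x} ⊔ Submodule.span F {y})
  have h2 : Module.finrank F ↥(Submodule.span F {x} ⊔ Submodule.span F {y}) = 2 := by
    have := Submodule.finrank_sup_add_finrank_inf_eq (Submodule.span F {x}) (Submodule.span F {y})
    have hy0 : y ≠ 0 := by rintro rfl; exact hy (zero_mem _)
    have hd : Submodule.span F {x} ⊓ Submodule.span F {y} = ⊥ := by
      rw [← disjoint_iff, Submodule.disjoint_span_singleton' hy0]
      exact hy
    rw [hd, finrank_span_singleton hx, finrank_span_singleton hy0, finrank_bot] at this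
    omega
  rw [h2] at h
  rw [← h]
  congr 1
  ext u
  simp only [Finset.mem_filter, Finset.mem_univ, true_and, Submodule.mem_sup,
    Submodule.mem_span_singleton]
  constructor
  · rintro ⟨h, h'⟩ _ ⟨_, ⟨c, rfl⟩, _, ⟨d, rfl⟩, rfl⟩
    simp [h, h', add_mul]
  · intro h
    exact ⟨h x ⟨x, ⟨1, one_smul _ _⟩, 0, ⟨0, by simp⟩, by simp⟩,
      h y ⟨0, ⟨0, by simp⟩, y, ⟨1, one_smul _ _⟩, by simp⟩⟩

open Classical in
/-- The number of elements of `D` on the hyperplane orthogonal to `u` for the trace form. -/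
def hyperplaneCount (F : Type*) {E : Type*} [Field F] [Field E] [Algebra F E] (D : Finset E)
    (u : E) : ℕ :=
  (D.filter fun x => Algebra.trace F E (x * u) = 0).card

omit [Fintype F] [Fintype E] in
open Classical in
theorem sum_hyperplaneCount (D : Finset E) (S : Finset E) :
    ∑ u ∈ S, hyperplaneCount F D u =
      ∑ x ∈ D, (S.filter fun u => Algebra.trace F E (x * u) = 0).card := by
  simp only [hyperplaneCount, Finset.card_filter]
  exact Finset.sum_comm

omit [Fintype F] in
open Classical in
theorem sum_hyperplaneCount_sq (D : Finset E) :
    ∑ u, hyperplaneCount F D u ^ 2 =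
      ∑ x ∈ D, ∑ y ∈ D, (Finset.univ.filter fun u : E => Algebra.trace F E (x * u) = 0 ∧
      Algebra.trace F E (y * u) = 0).card := by
  simp only [hyperplaneCount, Finset.card_filter, sq, Finset.sum_mul_sum]
  rw [Finset.sum_comm]
  refine Finset.sum_congr rfl fun x _ => ?_
  rw [Finset.sum_comm]
  refine Finset.sum_congr rfl fun y _ => Finset.sum_congr rfl fun u _ => ?_
  split_ifs <;> simp_all

/-- `D` is the set of elements of a subgroup of `Eˣ` containing `Fˣ`. -/
structure IsScalarSubgroup (F : Type*) {E : Type*} [Field F] [Field E] [Algebra F E]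
    (D : Finset E) : Prop where
  zero_notMem : (0 : E) ∉ D
  mul_mem : ∀ x ∈ D, ∀ y ∈ D, x * y ∈ D
  inv_mem : ∀ x ∈ D, x⁻¹ ∈ D
  algebraMap_mem : ∀ c : F, c ≠ 0 → algebraMap F E c ∈ D

namespace IsScalarSubgroup

variable {D : Finset E}

omit [Fintype F] [Fintype E] in
theorem ne_zero (hD : IsScalarSubgroup F D) {x : E} (hx : x ∈ D) : x ≠ 0 := by
  rintro rfl
  exact hD.zero_notMem hx

omit [Fintype E] in
open Classical in
theorem card_filter_span (hD : IsScalarSubgroup F D) {x : E} (hx : x ∈ D) :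
    (D.filter fun y => y ∈ Submodule.span F {x}).card = Fintype.card F - 1 := by
  have hx0 := hD.ne_zero hx
  have : (D.filter fun y => y ∈ Submodule.span F {x}) =
      (Finset.univ.erase (0 : F)).image fun c => c • x := by
    ext y
    simp only [Finset.mem_filter, Submodule.mem_span_singleton, Finset.mem_image, Finset.mem_erase,
      Finset.mem_univ, and_true]
    constructor
    · rintro ⟨hy, c, rfl⟩
      refine ⟨c, ?_, rfl⟩
      rintro rfl
      exact hD.ne_zero hy (zero_smul _ _)
    · rintro ⟨c, hc, rfl⟩
      refine ⟨?_, c, rfl⟩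
      rw [Algebra.smul_def]
      exact hD.mul_mem _ (hD.algebraMap_mem c hc) _ hx
  rw [this, Finset.card_image_of_injective _ (smul_left_injective F hx0),
    Finset.card_erase_of_mem (Finset.mem_univ _), Finset.card_univ]

omit [Fintype F] [Fintype E] in
theorem hyperplaneCount_mul (hD : IsScalarSubgroup F D) {d : E} (hd : d ∈ D) (u : E) :
    hyperplaneCount F D (d * u) = hyperplaneCount F D u := by
  classical
  have hd0 := hD.ne_zero hd
  refine Finset.card_bij (fun x _ => x * d) ?_ ?_ ?_
  · intro x hx
    simp only [Finset.mem_filter] at hx ⊢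
    exact ⟨hD.mul_mem _ hx.1 _ hd, by rw [mul_assoc]; exact hx.2⟩
  · intro x _ y _ h
    exact mul_right_cancel₀ hd0 h
  · intro y hy
    simp only [Finset.mem_filter] at hy
    refine ⟨y * d⁻¹, ?_, by field_simp⟩
    simp only [Finset.mem_filter]
    refine ⟨hD.mul_mem _ hy.1 _ (hD.inv_mem _ hd), ?_⟩
    rw [← hy.2]
    congr 1
    field_simp

theorem sum_hyperplaneCount_univ (h5 : Module.finrank F E = 5) (hD : IsScalarSubgroup F D) :
    ∑ u, hyperplaneCount F D u = D.card * Fintype.card F ^ 4 := by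
  classical
  rw [sum_hyperplaneCount, Finset.sum_congr rfl fun x hx =>
    card_trace_orthogonal_singleton h5 (hD.ne_zero hx)]
  simp

theorem sum_hyperplaneCount_sq_univ (h5 : Module.finrank F E = 5) (hD : IsScalarSubgroup F D) :
    (∑ u, (hyperplaneCount F D u : ℝ) ^ 2) = D.card * ((Fintype.card F - 1) * Fintype.card F ^ 4 +
      (D.card - (Fintype.card F - 1)) * Fintype.card F ^ 3) := by
  classical
  have key : ∀ x ∈ D, (∑ y ∈ D, ((Finset.univ.filter fun u : E =>
      Algebra.trace F E (x * u) = 0 ∧ Algebra.trace F E (y * u) = 0).card : ℝ)) =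
      (Fintype.card F - 1) * Fintype.card F ^ 4 +
      (D.card - (Fintype.card F - 1)) * Fintype.card F ^ 3 := by
    intro x hx
    have hx0 := hD.ne_zero hx
    have hq : 1 ≤ Fintype.card F := Fintype.card_pos
    rw [← Finset.sum_filter_add_sum_filter_not D (fun y => y ∈ Submodule.span F {x})]
    have hc := hD.card_filter_span hx
    have hc' := Finset.card_filter_add_card_filter_not (s := D)
      (fun y => y ∈ Submodule.span F {x})
    have h1 : ∀ y ∈ D.filter (fun y => y ∈ Submodule.span F {x}), ((Finset.univ.filter fun u : E =>
        Algebra.trace F E (x * u) = 0 ∧ Algebra.trace F E (y * u) = 0).card : ℝ) =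
        Fintype.card F ^ 4 := by
      intro y hy
      obtain ⟨c, rfl⟩ := Submodule.mem_span_singleton.1 (Finset.mem_filter.1 hy).2
      rw [← Nat.cast_pow, ← card_trace_orthogonal_singleton h5 hx0]
      congr 2
      ext u
      simp +contextual
    have h2 : ∀ y ∈ D.filter (fun y => ¬ y ∈ Submodule.span F {x}),
        ((Finset.univ.filter fun u : E =>
        Algebra.trace F E (x * u) = 0 ∧ Algebra.trace F E (y * u) = 0).card : ℝ) =
        Fintype.card F ^ 3 := by
      intro y hy
      rw [← Nat.cast_pow, ← card_trace_orthogonal_pair h5 hx0 (Finset.mem_filter.1 hy).2]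
    rw [Finset.sum_congr rfl h1, Finset.sum_congr rfl h2, Finset.sum_const, Finset.sum_const, hc]
    rw [hc] at hc'
    have : ((D.filter (fun y => ¬ y ∈ Submodule.span F {x})).card : ℝ) =
        D.card - (Fintype.card F - 1) := by
      rw [← hc']
      push_cast [hq]
      ring
    rw [nsmul_eq_mul, nsmul_eq_mul, this]
    push_cast [hq]
    ring
  have h := sum_hyperplaneCount_sq (F := F) D
  have h' : (∑ u, (hyperplaneCount F D u : ℝ) ^ 2) =
      ∑ x ∈ D, ∑ y ∈ D, ((Finset.univ.filter fun u : E => Algebra.trace F E (x * u) = 0 ∧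
      Algebra.trace F E (y * u) = 0).card : ℝ) := by
    exact_mod_cast h
  rw [h', Finset.sum_congr rfl key, Finset.sum_const, nsmul_eq_mul]

theorem sum_hyperplaneCount_variance (h5 : Module.finrank F E = 5) (hD : IsScalarSubgroup F D) :
    (∑ u, ((hyperplaneCount F D u : ℝ) - D.card / Fintype.card F) ^ 2) =
      D.card * ((Fintype.card F - 1) ^ 2 * Fintype.card F ^ 3) := by
  have hq : (0 : ℝ) < Fintype.card F := by exact_mod_cast Fintype.card_pos
  have hE : (Fintype.card E : ℝ) = Fintype.card F ^ 5 := by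
    rw [Module.card_eq_pow_finrank (K := F), h5]
    push_cast
    ring
  have h1 := sum_hyperplaneCount_univ h5 hD
  have h1' : (∑ u, (hyperplaneCount F D u : ℝ)) = D.card * Fintype.card F ^ 4 := by
    exact_mod_cast h1
  simp only [sub_sq, Finset.sum_add_distrib, Finset.sum_sub_distrib, ← Finset.sum_mul,
    ← Finset.mul_sum, sum_hyperplaneCount_sq_univ h5 hD, h1', Finset.sum_const, Finset.card_univ,
    nsmul_eq_mul, hE]
  field_simp
  ring

theorem abs_hyperplaneCount_sub_le (h5 : Module.finrank F E = 5) (hD : IsScalarSubgroup F D)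
    (hD' : D.Nonempty) {u : E} (hu : u ≠ 0) :
    |(hyperplaneCount F D u : ℝ) - D.card / Fintype.card F| ≤
      (Fintype.card F - 1) * Fintype.card F * √(Fintype.card F) := by
  classical
  have hq : (1 : ℝ) ≤ Fintype.card F := by exact_mod_cast Fintype.card_pos
  have hN : (0 : ℝ) < D.card := by exact_mod_cast hD'.card_pos
  have h1 : (D.card : ℝ) * ((hyperplaneCount F D u : ℝ) - D.card / Fintype.card F) ^ 2 ≤
      D.card * ((Fintype.card F - 1) ^ 2 * Fintype.card F ^ 3) := by
    rw [← sum_hyperplaneCount_variance h5 hD]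
    have hinj : Set.InjOn (fun d => d * u) (D : Set E) := fun a _ b _ h => mul_right_cancel₀ hu h
    have h2 : ∑ v ∈ D.image (fun d => d * u),
        ((hyperplaneCount F D v : ℝ) - D.card / Fintype.card F) ^ 2 =
        D.card * ((hyperplaneCount F D u : ℝ) - D.card / Fintype.card F) ^ 2 := by
      rw [Finset.sum_image hinj, Finset.sum_congr rfl fun d hd => by
        rw [hD.hyperplaneCount_mul hd u]]
      simp
    rw [← h2]
    exact Finset.sum_le_univ_sum_of_nonneg fun _ => sq_nonneg _
  have h3 := le_of_mul_le_mul_left h1 hN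
  apply abs_le_of_sq_le_sq _ (by
    have := Real.sqrt_nonneg (Fintype.card F : ℝ)
    nlinarith [mul_nonneg (mul_nonneg (sub_nonneg.2 hq) (zero_le_one.trans hq)) this])
  refine h3.trans (le_of_eq ?_)
  rw [mul_pow, mul_pow, Real.sq_sqrt (by positivity)]
  ring

open Classical in
/-- A subgroup of index `e` containing the scalars meets a three-dimensional subspace in about
`(q ^ 3 - q⁻²) / e` points. -/
theorem abs_card_filter_mem_sub_le (h5 : Module.finrank F E = 5) (hD : IsScalarSubgroup F D)
    (hD' : D.Nonempty) (V : Submodule F E) (hV : Module.finrank F V = 3) :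
    |((D.filter fun x => x ∈ V).card : ℝ) - D.card / (Fintype.card F : ℝ) ^ 2| ≤
      ((Fintype.card F : ℝ) ^ 2 - 1) * √(Fintype.card F) := by
  have hq1 : (1 : ℝ) < Fintype.card F := by exact_mod_cast Fintype.one_lt_card
  have hq : (0 : ℝ) < Fintype.card F := by linarith
  set B : Finset E := Finset.univ.filter fun u : E => ∀ x ∈ V, Algebra.trace F E (x * u) = 0
    with hB
  have hBc : B.card = Fintype.card F ^ 2 := by
    rw [hB, card_trace_orthogonal h5, hV]
  have h0 : (0 : E) ∈ B := by simp [hB]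
  have hin : ∀ x ∈ V, (B.filter fun u => Algebra.trace F E (x * u) = 0).card =
      Fintype.card F ^ 2 := by
    intro x hx
    rw [← hBc, Finset.filter_true_of_mem]
    intro u hu
    exact (Finset.mem_filter.1 hu).2 x hx
  have hout : ∀ x, x ∉ V → (B.filter fun u => Algebra.trace F E (x * u) = 0).card =
      Fintype.card F := by
    intro x hx
    have hx0 : x ≠ 0 := by rintro rfl; exact hx (zero_mem _)
    have h := card_trace_orthogonal h5 (V ⊔ Submodule.span F {x})
    have h4 : Module.finrank F ↥(V ⊔ Submodule.span F {x}) = 4 := by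
      have := Submodule.finrank_sup_add_finrank_inf_eq V (Submodule.span F {x})
      have hd : V ⊓ Submodule.span F {x} = ⊥ := by
        rw [← disjoint_iff, Submodule.disjoint_span_singleton' hx0]
        exact hx
      rw [hd, finrank_span_singleton hx0, finrank_bot] at this
      omega
    rw [h4, pow_one] at h
    rw [← h]
    congr 1
    ext u
    simp only [hB, Finset.mem_filter, Finset.mem_univ, true_and, Submodule.mem_sup,
      Submodule.mem_span_singleton]
    constructor
    · rintro ⟨h, h'⟩ _ ⟨v, hv, _, ⟨d, rfl⟩, rfl⟩
      simp [h v hv, h', add_mul]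
    · intro h
      exact ⟨fun v hv => h v ⟨v, hv, 0, ⟨0, by simp⟩, by simp⟩,
        h x ⟨0, zero_mem _, x, ⟨1, one_smul _ _⟩, by simp⟩⟩
  have hsum : (∑ u ∈ B, (hyperplaneCount F D u : ℝ)) =
      (D.filter fun x => x ∈ V).card * (Fintype.card F : ℝ) ^ 2 +
      (D.card - (D.filter fun x => x ∈ V).card) * Fintype.card F := by
    have h := sum_hyperplaneCount (F := F) D B
    rw [← Finset.sum_filter_add_sum_filter_not D (fun y => y ∈ V),
      Finset.sum_congr rfl fun x hx => hin x (Finset.mem_filter.1 hx).2,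
      Finset.sum_congr rfl fun x hx => hout x (Finset.mem_filter.1 hx).2,
      Finset.sum_const, Finset.sum_const] at h
    have hc' := Finset.card_filter_add_card_filter_not (s := D) (fun y => y ∈ V)
    have h' : (∑ u ∈ B, (hyperplaneCount F D u : ℝ)) =
        ((∑ u ∈ B, hyperplaneCount F D u : ℕ) : ℝ) := by
      push_cast
      rfl
    rw [h', h, ← hc']
    push_cast [nsmul_eq_mul]
    ring
  have hM0 : hyperplaneCount F D 0 = D.card := by simp [hyperplaneCount]
  have hdev : |∑ u ∈ B.erase 0, ((hyperplaneCount F D u : ℝ) - D.card / Fintype.card F)| ≤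
      ((Fintype.card F : ℝ) ^ 2 - 1) *
        ((Fintype.card F - 1) * Fintype.card F * √(Fintype.card F)) := by
    refine (Finset.abs_sum_le_sum_abs _ _).trans ?_
    refine (Finset.sum_le_card_nsmul _ _ _ fun u hu =>
      hD.abs_hyperplaneCount_sub_le h5 hD' (Finset.mem_erase.1 hu).1).trans (le_of_eq ?_)
    rw [Finset.card_erase_of_mem h0, hBc, nsmul_eq_mul]
    push_cast [Nat.one_le_pow _ _ (Fintype.card_pos (α := F))]
    ring
  rw [Finset.sum_sub_distrib, Finset.sum_erase_eq_sub h0, hsum, hM0, Finset.sum_const,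
    Finset.card_erase_of_mem h0, hBc, nsmul_eq_mul] at hdev
  push_cast [Nat.one_le_pow _ _ (Fintype.card_pos (α := F))] at hdev
  have hpos : 0 < ((Fintype.card F : ℝ) - 1) * Fintype.card F := mul_pos (by linarith) hq
  rw [← mul_le_mul_iff_right₀ hpos, ← abs_of_pos hpos, ← abs_mul, abs_of_pos hpos]
  refine le_trans (le_of_eq ?_) (hdev.trans (le_of_eq ?_))
  · congr 1
    field_simp
    ring
  · ring

end IsScalarSubgroup

end Counting

section Sieve

variable {F E : Type*} [Field F] [Fintype F] [Field E] [Fintype E] [Algebra F E]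

open Classical in
/-- The nonzero `e`-th powers of a finite field, when `e` divides the order of its unit group. -/
def powerResidues (E : Type*) [Field E] [Fintype E] (e : ℕ) : Finset E :=
  Finset.univ.filter fun x => x ^ ((Fintype.card E - 1) / e) = 1

omit [Field F] [Fintype F] [Algebra F E] in
theorem mem_powerResidues {e : ℕ} {x : E} :
    x ∈ powerResidues E e ↔ x ^ ((Fintype.card E - 1) / e) = 1 := by
  simp [powerResidues]

theorem card_sub_one_pos (E : Type*) [Field E] [Fintype E] : 0 < Fintype.card E - 1 :=
  Nat.sub_pos_of_lt Fintype.one_lt_card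

theorem exists_isPrimitiveRoot_card_sub_one (E : Type*) [Field E] [Fintype E] :
    ∃ g : E, IsPrimitiveRoot g (Fintype.card E - 1) := by
  classical
  obtain ⟨g, hg⟩ := IsCyclic.exists_ofOrder_eq_natCard (α := Eˣ)
  refine ⟨(g : E), ?_⟩
  rw [IsPrimitiveRoot.coe_units_iff, ← Fintype.card_units, ← Nat.card_eq_fintype_card, ← hg]
  exact IsPrimitiveRoot.orderOf g

theorem card_powerResidues {e : ℕ} (he : e ∣ Fintype.card E - 1) :
    (powerResidues E e).card = (Fintype.card E - 1) / e := by
  classical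
  obtain ⟨n, hn⟩ := he
  have hpos := card_sub_one_pos E
  have he0 : 0 < e := Nat.pos_of_ne_zero (by rintro rfl; simp at hn; omega)
  have hn0 : 0 < n := Nat.pos_of_ne_zero (by rintro rfl; simp at hn; omega)
  obtain ⟨g, hg⟩ := exists_isPrimitiveRoot_card_sub_one E
  have h := (hg.pow hpos hn).card_nthRootsFinset
  have hd : (Fintype.card E - 1) / e = n := by rw [hn, Nat.mul_div_cancel_left _ he0]
  rw [hd]
  conv_rhs => rw [← h]
  congr 1
  ext x
  rw [mem_powerResidues, Polynomial.mem_nthRootsFinset hn0, hd]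

theorem isScalarSubgroup_powerResidues {e : ℕ}
    (he : Fintype.card F - 1 ∣ (Fintype.card E - 1) / e) (he' : e ∣ Fintype.card E - 1) :
    IsScalarSubgroup F (powerResidues E e) where
  zero_notMem h := by
    rw [mem_powerResidues, zero_pow] at h
    · exact zero_ne_one h
    · exact (Nat.div_pos (Nat.le_of_dvd (card_sub_one_pos E) he')
        (Nat.pos_of_dvd_of_pos he' (card_sub_one_pos E))).ne'
  mul_mem x hx y hy := by
    rw [mem_powerResidues] at *
    rw [mul_pow, hx, hy, one_mul]
  inv_mem x hx := by
    rw [mem_powerResidues] at *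
    rw [inv_pow, hx, inv_one]
  algebraMap_mem c hc := by
    obtain ⟨m, hm⟩ := he
    rw [mem_powerResidues, ← map_pow, hm, pow_mul, FiniteField.pow_card_sub_one_eq_one c hc,
      one_pow, map_one]

theorem mem_powerResidues_mul {e d : ℕ} (h : e.Coprime d) (hed : e * d ∣ Fintype.card E - 1)
    {x : E} : x ∈ powerResidues E (e * d) ↔ x ∈ powerResidues E e ∧ x ∈ powerResidues E d := by
  simp only [mem_powerResidues, ← orderOf_dvd_iff_pow_eq_one]
  obtain ⟨n, hn⟩ := hed
  have hpos := card_sub_one_pos E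
  have he0 : 0 < e := Nat.pos_of_ne_zero (by rintro rfl; simp at hn; omega)
  have hd0 : 0 < d := Nat.pos_of_ne_zero (by rintro rfl; simp at hn; omega)
  have h1 : (Fintype.card E - 1) / (e * d) = n := by
    rw [hn, Nat.mul_div_cancel_left _ (Nat.mul_pos he0 hd0)]
  have h2 : (Fintype.card E - 1) / e = d * n := by
    rw [hn, mul_assoc, Nat.mul_div_cancel_left _ he0]
  have h3 : (Fintype.card E - 1) / d = e * n := by
    rw [hn, mul_comm e d, mul_assoc, Nat.mul_div_cancel_left _ hd0]
  rw [h1, h2, h3]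
  constructor
  · exact fun h => ⟨h.mul_left _, h.mul_left _⟩
  · rintro ⟨ha, hb⟩
    have := Nat.dvd_gcd ha hb
    rwa [Nat.gcd_mul_right, Nat.gcd_comm, h.gcd_eq_one, one_mul] at this

theorem card_sub_one_eq (h5 : Module.finrank F E = 5) :
    Fintype.card E - 1 = (Fintype.card F - 1) * ∑ i ∈ Finset.range 5, Fintype.card F ^ i := by
  rw [Module.card_eq_pow_finrank (K := F), h5, mul_comm, Nat.geomSum_eq Fintype.one_lt_card]
  exact (Nat.div_mul_cancel (by simpa using Nat.sub_dvd_pow_sub_pow (Fintype.card F) 1 5)).symm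

theorem card_sub_one_div (h5 : Module.finrank F E = 5) {e : ℕ}
    (he : e ∣ ∑ i ∈ Finset.range 5, Fintype.card F ^ i) :
    (Fintype.card E - 1) / e =
      (Fintype.card F - 1) * ((∑ i ∈ Finset.range 5, Fintype.card F ^ i) / e) := by
  rw [card_sub_one_eq h5, Nat.mul_div_assoc _ he]

theorem dvd_card_sub_one (h5 : Module.finrank F E = 5) {e : ℕ}
    (he : e ∣ ∑ i ∈ Finset.range 5, Fintype.card F ^ i) : e ∣ Fintype.card E - 1 := by
  rw [card_sub_one_eq h5]
  exact he.mul_left _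

open Classical in
theorem abs_card_powerResidues_sub_le (h5 : Module.finrank F E = 5) (V : Submodule F E)
    (hV : Module.finrank F V = 3) {e : ℕ} (he : e ∣ ∑ i ∈ Finset.range 5, Fintype.card F ^ i) :
    |(((powerResidues E e).filter fun x => x ∈ V).card : ℝ) -
      ((Fintype.card E - 1 : ℕ) : ℝ) / (Fintype.card F : ℝ) ^ 2 / e| ≤
      ((Fintype.card F : ℝ) ^ 2 - 1) * √(Fintype.card F) := by
  have hd := dvd_card_sub_one (F := F) h5 he
  have hS := isScalarSubgroup_powerResidues (F := F) (E := E)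
    (by rw [card_sub_one_div h5 he]; exact dvd_mul_right _ _) hd
  have h := hS.abs_card_filter_mem_sub_le h5 ⟨1, by simp [mem_powerResidues]⟩ V hV
  have he0 : (e : ℝ) ≠ 0 := by
    have := Nat.pos_of_dvd_of_pos hd (card_sub_one_pos E)
    positivity
  rw [card_powerResidues hd, Nat.cast_div hd he0] at h
  rwa [div_right_comm]

open Classical in
/-- The elements of `V` that are nonzero `e`-th powers but not `d`-th powers for `d ∈ P`. -/
def sifted (V : Submodule F E) (P : Finset ℕ) (e : ℕ) : Finset E :=
  (powerResidues E e).filter fun x => x ∈ V ∧ ∀ d ∈ P, x ∉ powerResidues E d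

theorem abs_card_sifted_sub_le (h5 : Module.finrank F E = 5) (V : Submodule F E)
    (hV : Module.finrank F V = 3) (P : Finset ℕ) (hP : ∀ d ∈ P, d.Prime) (e : ℕ)
    (heP : ∀ d ∈ P, e.Coprime d) (he : e * ∏ d ∈ P, d ∣ ∑ i ∈ Finset.range 5, Fintype.card F ^ i) :
    |((sifted V P e).card : ℝ) - ((Fintype.card E - 1 : ℕ) : ℝ) / (Fintype.card F : ℝ) ^ 2 / e *
      ∏ d ∈ P, (1 - 1 / (d : ℝ))| ≤
      2 ^ P.card * (((Fintype.card F : ℝ) ^ 2 - 1) * √(Fintype.card F)) := by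
  classical
  induction P using Finset.induction_on generalizing e with
  | empty =>
    simpa [sifted] using abs_card_powerResidues_sub_le h5 V hV (e := e) (by simpa using he)
  | insert d P hd ih =>
    have hP' : ∀ d ∈ P, d.Prime := fun x hx => hP x (Finset.mem_insert_of_mem hx)
    have hdp : d.Prime := hP d (Finset.mem_insert_self _ _)
    rw [Finset.prod_insert hd] at he
    have h1 := ih hP' e (fun x hx => heP x (Finset.mem_insert_of_mem hx))
      ((mul_dvd_mul_left e (dvd_mul_left _ d)).trans he)
    have h2 := ih hP' (e * d) (fun x hx => Nat.Coprime.mul_left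
      (heP x (Finset.mem_insert_of_mem hx)) ((Nat.coprime_primes hdp (hP' x hx)).2
        (by rintro rfl; exact hd hx))) (by rwa [mul_assoc])
    have hed : e * d ∣ Fintype.card E - 1 :=
      dvd_card_sub_one (F := F) h5 ((Dvd.intro (∏ x ∈ P, x) (by ring)).trans he)
    have hcard : (sifted V (insert d P) e).card + (sifted V P (e * d)).card =
        (sifted V P e).card := by
      rw [← Finset.card_filter_add_card_filter_not (s := sifted V P e)
        (fun x => x ∈ powerResidues E d), add_comm]
      congr 2
      · ext x
        simp only [sifted, Finset.mem_filter,
          mem_powerResidues_mul (heP d (Finset.mem_insert_self _ _)) hed]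
        tauto
      · ext x
        simp only [sifted, Finset.mem_filter, Finset.forall_mem_insert]
        tauto
    rw [Finset.card_insert_of_notMem hd, Finset.prod_insert hd, pow_succ (2 : ℝ) P.card]
    have hcard' : ((sifted V (insert d P) e).card : ℝ) = (sifted V P e).card -
        (sifted V P (e * d)).card := by
      rw [← hcard]
      push_cast
      ring
    have hd0 : (d : ℝ) ≠ 0 := by exact_mod_cast hdp.ne_zero
    rw [hcard']
    push_cast at h2
    rw [abs_le] at *
    have key : ((Fintype.card E - 1 : ℕ) : ℝ) / (Fintype.card F : ℝ) ^ 2 / e *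
      ((1 - 1 / (d : ℝ)) * ∏ d ∈ P, (1 - 1 / (d : ℝ))) =
      ((Fintype.card E - 1 : ℕ) : ℝ) / (Fintype.card F : ℝ) ^ 2 / e *
      ∏ d ∈ P, (1 - 1 / (d : ℝ)) - ((Fintype.card E - 1 : ℕ) : ℝ) / (Fintype.card F : ℝ) ^ 2 /
      (e * d) * ∏ d ∈ P, (1 - 1 / (d : ℝ)) := by
      rw [← div_div _ (e : ℝ) (d : ℝ)]
      ring
    rw [key]
    constructor <;> linarith [h1.1, h1.2, h2.1, h2.2]

omit [Fintype F] in
theorem sifted_one_eq (V : Submodule F E) (P : Finset ℕ) {x : E} :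
    x ∈ sifted V P 1 ↔ x ≠ 0 ∧ x ∈ V ∧ ∀ d ∈ P, x ^ ((Fintype.card E - 1) / d) ≠ 1 := by
  have : x ∈ powerResidues E 1 ↔ x ≠ 0 := by
    rw [mem_powerResidues, Nat.div_one]
    refine ⟨?_, FiniteField.pow_card_sub_one_eq_one x⟩
    rintro h rfl
    rw [zero_pow (card_sub_one_pos E).ne'] at h
    exact zero_ne_one h
  simp only [sifted, Finset.mem_filter, this, mem_powerResidues, ne_eq]

open Classical in
theorem le_card_sifted_one (h5 : Module.finrank F E = 5) (V : Submodule F E)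
    (hV : Module.finrank F V = 3) (P : Finset ℕ)
    (hP : ∀ d ∈ P, d ∣ ∑ i ∈ Finset.range 5, Fintype.card F ^ i) :
    (Fintype.card F : ℝ) ^ 3 - 1 - ∑ d ∈ P, ((Fintype.card F : ℝ) ^ 3 / d +
      ((Fintype.card F : ℝ) ^ 2 - 1) * √(Fintype.card F)) ≤ (sifted V P 1).card := by
  have hq : (0 : ℝ) < Fintype.card F := by exact_mod_cast Fintype.card_pos
  set V' : Finset E := Finset.univ.filter fun x => x ∈ V ∧ x ≠ 0 with hV'
  have hc : V'.card + 1 = Fintype.card F ^ 3 := by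
    have h : (Finset.univ.filter (· ∈ V)).erase 0 = V' := by
      ext x
      simp [hV', and_comm]
    rw [← h, Finset.card_erase_add_one (by simp), ← hV, ← Module.card_eq_pow_finrank,
      Fintype.card_subtype]
  have hsub : V' ⊆ sifted V P 1 ∪ P.biUnion fun d =>
      (powerResidues E d).filter fun x => x ∈ V := by
    intro x hx
    simp only [hV', Finset.mem_filter, Finset.mem_univ, true_and] at hx
    simp only [Finset.mem_union, sifted_one_eq, Finset.mem_biUnion, Finset.mem_filter,
      mem_powerResidues]
    by_cases h : ∃ d ∈ P, x ^ ((Fintype.card E - 1) / d) = 1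
    · obtain ⟨d, hd, h⟩ := h
      exact Or.inr ⟨d, hd, h, hx.1⟩
    · push Not at h
      exact Or.inl ⟨hx.2, hx.1, h⟩
  have h1 := (Finset.card_le_card hsub).trans ((Finset.card_union_le _ _).trans
    (Nat.add_le_add_left Finset.card_biUnion_le _))
  have h2 : ∀ d ∈ P, ((((powerResidues E d).filter fun x => x ∈ V).card : ℕ) : ℝ) ≤
      (Fintype.card F : ℝ) ^ 3 / d + ((Fintype.card F : ℝ) ^ 2 - 1) * √(Fintype.card F) := by
    intro d hd
    have h := (abs_le.1 (abs_card_powerResidues_sub_le h5 V hV (hP d hd))).2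
    have h3 : ((Fintype.card E - 1 : ℕ) : ℝ) / (Fintype.card F : ℝ) ^ 2 / d ≤
        (Fintype.card F : ℝ) ^ 3 / d := by
      gcongr
      rw [div_le_iff₀ (by positivity), ← pow_add]
      rw [Module.card_eq_pow_finrank (K := F), h5]
      exact_mod_cast Nat.sub_le _ _
    linarith
  have h3 := Finset.sum_le_sum h2
  have h1' : (V'.card : ℝ) ≤ (sifted V P 1).card + ∑ d ∈ P,
      ((((powerResidues E d).filter fun x => x ∈ V).card : ℕ) : ℝ) := by
    exact_mod_cast h1
  have hc' : (V'.card : ℝ) + 1 = (Fintype.card F : ℝ) ^ 3 := by exact_mod_cast hc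
  linarith

end Sieve

section Normality

variable {F E : Type*} [Field F] [Fintype F] [Field E] [Fintype E] [Algebra F E]

/-- The Frobenius `x ↦ x ^ q` of `E` over the field `F` with `q` elements, as a linear map. -/
def frob (F E : Type*) [Field F] [Fintype F] [Field E] [Algebra F E] : E →ₗ[F] E :=
  (FiniteField.frobeniusAlgHom F E).toLinearMap

omit [Fintype E] in
theorem frob_apply (x : E) : frob F E x = x ^ Fintype.card F := by
  simp [frob]

omit [Fintype E] in
theorem frob_mul (x y : E) : frob F E (x * y) = frob F E x * frob F E y := by
  simp [frob_apply, mul_pow]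

omit [Fintype E] in
theorem frob_pow_apply (n : ℕ) (x : E) : (frob F E ^ n) x = x ^ Fintype.card F ^ n := by
  induction n with
  | zero => simp
  | succ n ih => rw [pow_succ', Module.End.mul_apply, ih, frob_apply, ← pow_mul, pow_succ]

theorem frob_pow_five_apply (h5 : Module.finrank F E = 5) (x : E) : (frob F E ^ 5) x = x := by
  rw [frob_pow_apply, ← h5, ← Module.card_eq_pow_finrank, FiniteField.pow_card]

theorem frob_pow_five (h5 : Module.finrank F E = 5) : frob F E ^ 5 = 1 :=
  LinearMap.ext fun x => frob_pow_five_apply h5 x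

omit [Fintype E] in
theorem gPoly_eq (α : E) : gPoly (Fintype.card F) 5 α =
    ∑ i ∈ Finset.range 5, C ((frob F E ^ i) α) * X ^ (5 - 1 - i) := by
  simp only [gPoly, frob_pow_apply]

omit [Fintype E] in
theorem gPoly_add (α β : E) : gPoly (Fintype.card F) 5 (α + β) =
    gPoly (Fintype.card F) 5 α + gPoly (Fintype.card F) 5 β := by
  simp only [gPoly_eq, map_add, add_mul, Finset.sum_add_distrib]

omit [Fintype E] in
theorem gPoly_smul (c : F) (α : E) : gPoly (Fintype.card F) 5 (c • α) =
    C (algebraMap F E c) * gPoly (Fintype.card F) 5 α := by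
  simp only [gPoly_eq, LinearMap.map_smul]
  simp only [Algebra.smul_def, map_mul, Finset.mul_sum, mul_assoc]

theorem X_mul_gPoly (h5 : Module.finrank F E = 5) (α : E) :
    X * gPoly (Fintype.card F) 5 α =
      gPoly (Fintype.card F) 5 (frob F E α) + C α * (X ^ 5 - 1) := by
  have h : ∀ i, (frob F E ^ i) (frob F E α) = (frob F E ^ (i + 1)) α := fun i => by
    rw [pow_succ, Module.End.mul_apply]
  simp only [gPoly_eq, h, Finset.sum_range_succ, Finset.sum_range_zero,
    frob_pow_five_apply h5 α, pow_zero, Module.End.one_apply]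
  norm_num
  ring

theorem dvd_map_mul_gPoly_sub (h5 : Module.finrank F E = 5) (R : F[X]) (α : E) :
    (X : E[X]) ^ 5 - 1 ∣ R.map (algebraMap F E) * gPoly (Fintype.card F) 5 α -
      gPoly (Fintype.card F) 5 (aeval (frob F E) R α) := by
  induction R using Polynomial.induction_on generalizing α with
  | C a => simp [gPoly_smul]
  | add p r hp hr =>
    have := dvd_add (hp α) (hr α)
    simp only [map_add, Polynomial.map_add, LinearMap.add_apply, gPoly_add]
    convert this using 1
    ring
  | monomial n a h =>
    have h1 := h (frob F E α)
    have h2 : aeval (frob F E) (C a * X ^ (n + 1)) α =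
        aeval (frob F E) (C a * X ^ n) (frob F E α) := by
      rw [pow_succ, ← mul_assoc, map_mul, aeval_X, Module.End.mul_apply]
    rw [h2]
    have h3 : (C a * X ^ (n + 1)).map (algebraMap F E) * gPoly (Fintype.card F) 5 α =
        (C a * X ^ n).map (algebraMap F E) * gPoly (Fintype.card F) 5 (frob F E α) +
        (C a * X ^ n).map (algebraMap F E) * C α * (X ^ 5 - 1) := by
      rw [pow_succ, ← mul_assoc, Polynomial.map_mul, map_X, mul_assoc, X_mul_gPoly h5]
      ring
    rw [h3, add_sub_right_comm]
    exact dvd_add h1 (dvd_mul_left _ _)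

omit [Fintype E] in
theorem eq_zero_of_X_pow_five_sub_one_dvd_gPoly {q : ℕ} {α : E}
    (h : (X : E[X]) ^ 5 - 1 ∣ gPoly q 5 α) : α = 0 := by
  have hdeg : (gPoly q 5 α).degree < ((X : E[X]) ^ 5 - 1).degree := by
    have h5 : ((X : E[X]) ^ 5 - 1).degree = ((5 : ℕ) : WithBot ℕ) := by
      simpa using degree_X_pow_sub_C (n := 5) (by norm_num) (1 : E)
    rw [h5, degree_lt_iff_coeff_zero]
    intro m hm
    simp only [gPoly, finsetSum_coeff, coeff_C_mul, coeff_X_pow]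
    refine Finset.sum_eq_zero fun i hi => ?_
    rw [if_neg (by have := Finset.mem_range.1 hi; lia), mul_zero]
  have h0 := eq_zero_of_dvd_of_degree_lt h hdeg
  have := congrArg (coeff · 4) h0
  simpa [gPoly, Finset.sum_range_succ, coeff_X_pow, -map_pow] using this

/-- A criterion for `2`-normality in terms of a factorization `X ^ 5 - 1 = M * M'`. -/
theorem isKNormal_two_of_aeval_frob (h5 : Module.finrank F E = 5) {M M' : F[X]}
    (hM : M * M' = X ^ 5 - 1) (hM' : M'.natDegree = 2) (S : Set F[X])
    (hS : ∀ π : E[X], Irreducible π → π ∣ M.map (algebraMap F E) →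
      ∃ R ∈ S, M.map (algebraMap F E) ∣ π * R.map (algebraMap F E))
    {α : E} (hα : aeval (frob F E) M α = 0) (hα' : ∀ R ∈ S, aeval (frob F E) R α ≠ 0) :
    IsKNormal (Fintype.card F) 5 2 α := by
  set g := gPoly (Fintype.card F) 5 α with hg
  have hME : M.map (algebraMap F E) * M'.map (algebraMap F E) = (X : E[X]) ^ 5 - 1 := by
    rw [← Polynomial.map_mul, hM]
    simp
  have hne : (X : E[X]) ^ 5 - 1 ≠ 0 := by
    simpa using X_pow_sub_C_ne_zero (n := 5) (by norm_num) (1 : E)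
  have hM0 : M.map (algebraMap F E) ≠ 0 := left_ne_zero_of_mul (hME ▸ hne)
  have hM0' : M'.map (algebraMap F E) ≠ 0 := right_ne_zero_of_mul (hME ▸ hne)
  have h1 : M'.map (algebraMap F E) ∣ g := by
    have := dvd_map_mul_gPoly_sub h5 M α
    rw [hα, show gPoly (Fintype.card F) 5 (0 : E) = 0 by
      simp [gPoly_eq], sub_zero, ← hME] at this
    exact (mul_dvd_mul_iff_left hM0).1 this
  unfold IsKNormal
  rw [← hg]
  set D := @EuclideanDomain.gcd (Polynomial E) _ (Classical.decEq _) ((X : E[X]) ^ 5 - 1) g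
    with hD
  have hD1 : D ∣ (X : E[X]) ^ 5 - 1 := @EuclideanDomain.gcd_dvd_left _ _ (Classical.decEq _) _ _
  have hD2 : D ∣ g := @EuclideanDomain.gcd_dvd_right _ _ (Classical.decEq _) _ _
  obtain ⟨D', hD'⟩ : M'.map (algebraMap F E) ∣ D :=
    @EuclideanDomain.dvd_gcd _ _ (Classical.decEq _) _ _ _ (hME ▸ dvd_mul_left _ _) h1
  have hDM : D' ∣ M.map (algebraMap F E) := by
    rw [hD', ← hME, mul_comm (M.map _)] at hD1
    exact (mul_dvd_mul_iff_left hM0').1 hD1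
  have hunit : IsUnit D' := by
    by_contra hu
    obtain ⟨π, hπ, hπD⟩ := WfDvdMonoid.exists_irreducible_factor hu (ne_zero_of_dvd_ne_zero hM0 hDM)
    obtain ⟨R, hR, hRd⟩ := hS π hπ (hπD.trans hDM)
    refine hα' R hR (eq_zero_of_X_pow_five_sub_one_dvd_gPoly (q := Fintype.card F) ?_)
    refine (dvd_sub_right ?_).1 (dvd_map_mul_gPoly_sub h5 R α)
    rw [← hME]
    have h2 : M'.map (algebraMap F E) * π ∣ g := (mul_dvd_mul_left _ hπD).trans (hD' ▸ hD2)
    refine (mul_dvd_mul_right hRd _).trans ?_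
    rw [mul_comm π, mul_assoc]
    exact mul_dvd_mul_left _ (by rwa [mul_comm π])
  rw [hD', natDegree_mul hM0' hunit.ne_zero, natDegree_eq_zero_of_isUnit hunit, natDegree_map, hM']

end Normality

section Kernels

variable {F E : Type*} [Field F] [Fintype F] [Field E] [Fintype E] [Algebra F E]

open Classical in
theorem card_ker_aeval_frob_le {R : F[X]} (hR : R ≠ 0) :
    (Finset.univ.filter fun x : E => aeval (frob F E) R x = 0).card ≤
      Fintype.card F ^ R.natDegree := by
  set q := Fintype.card F with hq
  have hq1 : 1 < q := Fintype.one_lt_card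
  set L : E[X] := ∑ i ∈ Finset.range (R.natDegree + 1), C (algebraMap F E (R.coeff i)) * X ^ q ^ i
    with hL
  have heval : ∀ x : E, L.eval x = aeval (frob F E) R x := fun x => by
    rw [aeval_eq_sum_range, LinearMap.sum_apply, hL, eval_finsetSum]
    refine Finset.sum_congr rfl fun i _ => ?_
    rw [LinearMap.smul_apply, frob_pow_apply, Algebra.smul_def]
    simp [hq]
  have hL0 : L ≠ 0 := by
    intro h
    have h1 := congrArg (coeff · (q ^ R.natDegree)) h
    simp only [hL, finsetSum_coeff, coeff_C_mul, coeff_X_pow, coeff_zero] at h1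
    rw [Finset.sum_eq_single R.natDegree] at h1
    · simp at h1
      exact hR h1
    · intro b _ hb
      rw [if_neg, mul_zero]
      exact fun h => hb (Nat.pow_right_injective hq1 h).symm
    · simp
  have hdeg : L.natDegree ≤ q ^ R.natDegree := by
    refine natDegree_sum_le_of_forall_le _ _ fun i hi => ?_
    refine (natDegree_C_mul_X_pow_le _ _).trans (Nat.pow_le_pow_right hq1.le ?_)
    exact Nat.lt_succ_iff.1 (Finset.mem_range.1 hi)
  calc _ ≤ L.roots.toFinset.card := by
        refine Finset.card_le_card fun x hx => ?_
        rw [Multiset.mem_toFinset, mem_roots hL0, IsRoot.def, heval]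
        exact (Finset.mem_filter.1 hx).2
    _ ≤ _ := (Multiset.toFinset_card_le _).trans ((card_roots' _).trans hdeg)

theorem finrank_ker_aeval_frob_le {R : F[X]} (hR : R ≠ 0) :
    Module.finrank F (LinearMap.ker (aeval (frob F E) R)) ≤ R.natDegree := by
  classical
  have h := card_ker_aeval_frob_le (E := E) hR
  rw [← Nat.pow_le_pow_iff_right (Fintype.one_lt_card (α := F))]
  rw [← Module.card_eq_pow_finrank, Fintype.card_subtype]
  simpa only [LinearMap.mem_ker] using h

theorem finrank_ker_aeval_frob (h5 : Module.finrank F E = 5) {M M' : F[X]}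
    (hM : M * M' = X ^ 5 - 1) :
    Module.finrank F (LinearMap.ker (aeval (frob F E) M)) = M.natDegree := by
  have hne : (X : F[X]) ^ 5 - 1 ≠ 0 := by
    simpa using X_pow_sub_C_ne_zero (n := 5) (by norm_num) (1 : F)
  have hdeg : ((X : F[X]) ^ 5 - 1).natDegree = 5 := by
    simpa using natDegree_X_pow_sub_C (n := 5) (r := (1 : F))
  have hM0 : M ≠ 0 := left_ne_zero_of_mul (hM ▸ hne)
  have hM0' : M' ≠ 0 := right_ne_zero_of_mul (hM ▸ hne)
  have hsum : M.natDegree + M'.natDegree = 5 := by rw [← natDegree_mul hM0 hM0', hM, hdeg]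
  have h1 := finrank_ker_aeval_frob_le (E := E) hM0
  have h2 := finrank_ker_aeval_frob_le (E := E) hM0'
  have h3 := LinearMap.finrank_range_add_finrank_ker (aeval (frob F E) M')
  have h4 : LinearMap.range (aeval (frob F E) M') ≤ LinearMap.ker (aeval (frob F E) M) := by
    rw [LinearMap.range_le_ker_iff, ← Module.End.mul_eq_comp, ← map_mul, hM]
    simp [frob_pow_five h5]
  have h5' := Submodule.finrank_mono h4
  lia

theorem card_field_mod (h5 : Module.finrank F E = 5) : Fintype.card E = Fintype.card F ^ 5 := by
  rw [Module.card_eq_pow_finrank (K := F), h5]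

theorem exists_mem_sifted (V : Submodule F E) (P : Finset ℕ) (S : Finset F[X])
    (hS : ∀ R ∈ S, R ≠ 0)
    (h : ∑ R ∈ S, (Fintype.card F ^ R.natDegree - 1) < (sifted V P 1).card) :
    ∃ α ∈ sifted V P 1, ∀ R ∈ S, aeval (frob F E) R α ≠ 0 := by
  classical
  by_contra! hcon
  refine h.not_ge ?_
  have hsub : sifted V P 1 ⊆ S.biUnion fun R =>
      (Finset.univ.filter fun x : E => aeval (frob F E) R x = 0).erase 0 := fun x hx => by
    obtain ⟨R, hR, hRx⟩ := hcon x hx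
    rw [Finset.mem_biUnion]
    refine ⟨R, hR, Finset.mem_erase.2 ⟨((sifted_one_eq V P).1 hx).1, by simpa using hRx⟩⟩
  refine (Finset.card_le_card hsub).trans (Finset.card_biUnion_le.trans ?_)
  refine Finset.sum_le_sum fun R hR => ?_
  rw [Finset.card_erase_of_mem (by simp)]
  exact Nat.sub_le_sub_right (card_ker_aeval_frob_le (hS R hR)) 1

end Kernels

section Factorizations

variable {F : Type*} [Field F]

/-- A factorization `X ^ 5 - 1 = M * M'` over `F` with `M'` quadratic, together with a finite set
`S` of polynomials containing the cofactor in `M` of every irreducible factor of `M` over `E`. -/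
structure IsTwoNormalFactorization (F E : Type*) [Field F] [Field E] [Algebra F E]
    (M M' : F[X]) (S : Finset F[X]) : Prop where
  mul_eq : M * M' = X ^ 5 - 1
  natDegree_left : M.natDegree = 3
  natDegree_right : M'.natDegree = 2
  ne_zero : ∀ R ∈ S, R ≠ 0
  exists_cofactor : ∀ π : E[X], Irreducible π → π ∣ M.map (algebraMap F E) →
    ∃ R ∈ S, M.map (algebraMap F E) ∣ π * R.map (algebraMap F E)

theorem IsTwoNormalFactorization.isKNormal {E : Type*} [Fintype F] [Field E] [Fintype E]
    [Algebra F E] {M M' : F[X]} {S : Finset F[X]} (h : IsTwoNormalFactorization F E M M' S)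
    (h5 : Module.finrank F E = 5) {α : E} (hα : aeval (frob F E) M α = 0)
    (hα' : ∀ R ∈ S, aeval (frob F E) R α ≠ 0) : IsKNormal (Fintype.card F) 5 2 α :=
  isKNormal_two_of_aeval_frob h5 h.mul_eq h.natDegree_right S h.exists_cofactor hα hα'

theorem dvd_mul_of_irreducible_of_dvd {E : Type*} [Field E] {π f R M : E[X]} (hπ : Irreducible π)
    (hf : Irreducible f) (h : π ∣ f) (hM : M = f * R) : M ∣ π * R :=
  hM ▸ mul_dvd_mul_right (hπ.dvd_symm hf h) R

theorem isTwoNormalFactorization_of_five_eq_zero (h : (5 : F) = 0) (E : Type*) [Field E]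
    [Algebra F E] :
    IsTwoNormalFactorization F E ((X - 1) ^ 3) ((X - 1) ^ 2) {(X - 1) ^ 2} where
  mul_eq := by
    have h' : (5 : F[X]) = 0 := by
      have := congrArg C h
      rwa [map_ofNat, C_0] at this
    linear_combination (-X ^ 4 + 2 * X ^ 3 - 2 * X ^ 2 + X) * h'
  natDegree_left := by
    rw [natDegree_pow, ← C_1, natDegree_X_sub_C]
  natDegree_right := by
    rw [natDegree_pow, ← C_1, natDegree_X_sub_C]
  ne_zero R hR := by
    rw [Finset.mem_singleton.1 hR, ← C_1]
    exact pow_ne_zero _ (X_sub_C_ne_zero _)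
  exists_cofactor π hπ h := by
    refine ⟨_, Finset.mem_singleton_self _, ?_⟩
    simp only [Polynomial.map_pow, Polynomial.map_sub, map_X, Polynomial.map_one] at h ⊢
    refine dvd_mul_of_irreducible_of_dvd hπ (f := X - 1) ?_ (hπ.prime.dvd_of_dvd_pow h) (by ring)
    simpa using irreducible_X_sub_C (1 : E)

open Classical in
theorem isTwoNormalFactorization_of_golden {u : F} (hu : u ^ 2 = u + 1) (h5 : (5 : F) ≠ 0)
    (E : Type*) [Field E] [Algebra F E] (hE : ∀ x : E, x ^ 5 = 1 → x = 1) :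
    IsTwoNormalFactorization F E ((X - 1) * (X ^ 2 + C u * X + 1)) (X ^ 2 + C (1 - u) * X + 1)
      {X ^ 2 + C u * X + 1, X - 1} := by
  have hdeg : ∀ c : F, (X ^ 2 + C c * X + 1 : F[X]).natDegree = 2 := fun c => by
    compute_degree!
  have hu' : C u ^ 2 = C u + 1 := by
    rw [← C_pow, hu]
    simp
  have hX1 : (X - 1 : F[X]) ≠ 0 := by simpa using X_sub_C_ne_zero (1 : F)
  have hq0 : (X ^ 2 + C u * X + 1 : F[X]) ≠ 0 := fun h0 => by
    simpa [h0] using hdeg u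
  have hmul : (X - 1) * (X ^ 2 + C u * X + 1) * (X ^ 2 + C (1 - u) * X + 1) = X ^ 5 - 1 := by
    simp only [C_sub, C_1]
    linear_combination (-X ^ 3 + X ^ 2) * hu'
  refine ⟨hmul, ?_, hdeg _, ?_, ?_⟩
  · rw [natDegree_mul hX1 hq0, hdeg, ← C_1, natDegree_X_sub_C]
  · intro R hR
    rw [Finset.mem_insert, Finset.mem_singleton] at hR
    rcases hR with rfl | rfl
    exacts [hq0, hX1]
  · intro π hπ h
    have hq' : Irreducible ((X ^ 2 + C u * X + 1 : F[X]).map (algebraMap F E)) := by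
      have hd : ((X ^ 2 + C u * X + 1 : F[X]).map (algebraMap F E)).natDegree = 2 := by
        rw [natDegree_map, hdeg]
      refine (irreducible_iff_roots_eq_zero_of_degree_le_three (by rw [hd])
        (by rw [hd]; norm_num)).2
        (Multiset.eq_zero_of_forall_notMem fun x hx => ?_)
      have hx0 := isRoot_of_mem_roots hx
      have hx1 : x = 1 := by
        apply hE
        have hm := congrArg (fun p : F[X] => (p.map (algebraMap F E)).eval x) hmul
        simp only [Polynomial.map_mul, eval_mul] at hm
        rw [IsRoot.def.1 hx0] at hm
        simp at hm
        exact (sub_eq_zero.1 hm.symm)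
      rw [hx1] at hx0
      have h2 : algebraMap F E (u + 2) = 0 := by
        simp at hx0
        rw [map_add, map_ofNat]
        linear_combination hx0
      have h3 : u + 2 = 0 := (map_eq_zero _).1 h2
      apply h5
      linear_combination (u - 3) * h3 * (-1) + hu
    rw [Polynomial.map_mul] at h ⊢
    rcases hπ.prime.dvd_or_dvd h with h | h
    · refine ⟨X ^ 2 + C u * X + 1, by simp, dvd_mul_of_irreducible_of_dvd hπ ?_ h rfl⟩
      simpa using irreducible_X_sub_C (1 : E)
    · exact ⟨X - 1, by simp, dvd_mul_of_irreducible_of_dvd hπ hq' h (mul_comm _ _)⟩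

open Classical in
/-- The cofactors used when `X ^ 5 - 1` splits into linear factors. -/
def splitCofactors (c z : F) : Finset F[X] :=
  {(X - C (c * z)) * (X - C (c * z ^ 2)), (X - C c) * (X - C (c * z ^ 2)),
    (X - C c) * (X - C (c * z))}

/-- The cubic factor of `X ^ 5 - 1` used when it splits into linear factors. -/
def splitCubic (c z : F) : F[X] := (X - C c) * (X - C (c * z)) * (X - C (c * z ^ 2))

theorem isTwoNormalFactorization_split {c z : F} (hc : c ^ 5 = 1)
    (hz : 1 + z + z ^ 2 + z ^ 3 + z ^ 4 = 0) (E : Type*) [Field E] [Algebra F E] :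
    IsTwoNormalFactorization F E (splitCubic c z) ((X - C (c * z ^ 3)) * (X - C (c * z ^ 4)))
      (splitCofactors c z) := by
  have hne : ∀ a b : F, (X - C a) * (X - C b) ≠ 0 := fun a b =>
    mul_ne_zero (X_sub_C_ne_zero _) (X_sub_C_ne_zero _)
  have hdeg : ∀ a b : F, ((X - C a) * (X - C b)).natDegree = 2 := fun a b => by
    rw [natDegree_mul (X_sub_C_ne_zero _) (X_sub_C_ne_zero _), natDegree_X_sub_C,
      natDegree_X_sub_C]
  refine ⟨?_, ?_, hdeg _ _, ?_, ?_⟩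
  · have hc' : C c ^ 5 = 1 := by rw [← C_pow, hc, C_1]
    have hz' : 1 + C z + C z ^ 2 + C z ^ 3 + C z ^ 4 = 0 := by
      simp only [← C_pow, ← C_add, ← C_1, hz, C_0]
    have hz5 : C z ^ 5 = 1 := by linear_combination (C z - 1) * hz'
    simp only [splitCubic, C_mul, C_pow]
    linear_combination (-C c * X ^ 4 + C c ^ 2 * X ^ 3 * C z * (1 + C z ^ 2)
      - C c ^ 3 * X ^ 2 * C z ^ 3 * (1 + C z ^ 2) + C c ^ 4 * X * C z ^ 6) * hz'
      - C z ^ 10 * hc' - (C z ^ 5 + 1) * hz5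
  · rw [splitCubic, natDegree_mul (hne _ _) (X_sub_C_ne_zero _), hdeg, natDegree_X_sub_C]
  · intro R hR
    simp only [splitCofactors, Finset.mem_insert, Finset.mem_singleton] at hR
    rcases hR with rfl | rfl | rfl <;> exact hne _ _
  · intro π hπ h
    have hirr : ∀ a : F, Irreducible ((X - C a).map (algebraMap F E)) := fun a => by
      rw [Polynomial.map_sub, map_X, map_C]
      exact irreducible_X_sub_C _
    simp only [splitCubic, Polynomial.map_mul (p := _ * _) (q := _ - _),
      Polynomial.map_mul (p := _ - _) (q := _ - _)] at h
    rcases hπ.prime.dvd_or_dvd h with h | h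
    · rcases hπ.prime.dvd_or_dvd h with h | h
      · exact ⟨(X - C (c * z)) * (X - C (c * z ^ 2)), by simp [splitCofactors],
          dvd_mul_of_irreducible_of_dvd hπ (hirr c) h (by
            rw [splitCubic, ← Polynomial.map_mul, mul_assoc])⟩
      · exact ⟨(X - C c) * (X - C (c * z ^ 2)), by simp [splitCofactors],
          dvd_mul_of_irreducible_of_dvd hπ (hirr (c * z)) h (by
            rw [splitCubic, ← Polynomial.map_mul]; ring_nf)⟩
    · exact ⟨(X - C c) * (X - C (c * z)), by simp [splitCofactors],
          dvd_mul_of_irreducible_of_dvd hπ (hirr (c * z ^ 2)) h (by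
            rw [splitCubic, ← Polynomial.map_mul]; ring_nf)⟩

end Factorizations

section RootsOfUnity

variable {F : Type*} [Field F] [Fintype F]

theorem mem_range_algebraMap_of_pow_card_eq {K : Type*} [Field K] [Algebra F K] {x : K}
    (hx : x ^ Fintype.card F = x) : ∃ a : F, algebraMap F K a = x := by
  have h1 : (X ^ Fintype.card F - X : F[X]).natDegree = Fintype.card F :=
    FiniteField.X_pow_card_sub_X_natDegree_eq F Fintype.one_lt_card
  have h2 : (X ^ Fintype.card F - X : F[X]).roots.card =
      (X ^ Fintype.card F - X : F[X]).natDegree := by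
    rw [FiniteField.roots_X_pow_card_sub_X, h1]
    rfl
  have h3 := roots_map_of_injective_of_card_eq_natDegree (algebraMap F K).injective h2
  have h4 : x ∈ ((X ^ Fintype.card F - X : F[X]).map (algebraMap F K)).roots := by
    rw [mem_roots]
    · simp [hx]
    · rw [Polynomial.map_ne_zero_iff (algebraMap F K).injective]
      exact FiniteField.X_pow_card_sub_X_ne_zero F Fintype.one_lt_card
  rw [← h3, Multiset.mem_map] at h4
  obtain ⟨a, -, ha⟩ := h4
  exact ⟨a, ha⟩

theorem card_mod_five_of_five_eq_zero (h : (5 : F) = 0) : Fintype.card F % 5 = 0 := by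
  obtain ⟨p, hp⟩ := CharP.exists F
  have hpp : p.Prime := CharP.char_is_prime F p
  have h1 : p ∣ 5 := (CharP.cast_eq_zero_iff F p 5).1 (by simpa using h)
  have h2 : p ∣ Fintype.card F := (CharP.cast_eq_zero_iff F p _).1 (FiniteField.cast_card_eq_zero F)
  rw [(Nat.prime_dvd_prime_iff_eq hpp Nat.prime_five).1 h1] at h2
  exact Nat.mod_eq_zero_of_dvd h2

theorem exists_golden (h : Fintype.card F % 5 = 4) (h5 : (5 : F) ≠ 0) :
    ∃ u : F, u ^ 2 = u + 1 := by
  have : NeZero ((5 : ℕ) : AlgebraicClosure F) := ⟨by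
    rw [← map_natCast (algebraMap F (AlgebraicClosure F))]
    simpa using h5⟩
  obtain ⟨z, hz⟩ := HasEnoughRootsOfUnity.exists_primitiveRoot (AlgebraicClosure F) 5
  have hz5 := hz.pow_eq_one
  have hq : z ^ Fintype.card F = z ^ 4 := by
    conv_lhs =>
      rw [← Nat.div_add_mod (Fintype.card F) 5, h, pow_add, pow_mul, hz5, one_pow, one_mul]
  have hs : 1 + z + z ^ 2 + z ^ 3 + z ^ 4 = 0 := by
    have := hz.geom_sum_eq_zero (by norm_num)
    simpa [Finset.sum_range_succ] using this
  obtain ⟨u, hu⟩ := mem_range_algebraMap_of_pow_card_eq (F := F) (x := -(z + z ^ 4)) (by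
    have h1 : frob F (AlgebraicClosure F) (-(z + z ^ 4)) =
        -(frob F (AlgebraicClosure F) z + frob F (AlgebraicClosure F) (z ^ 4)) := by
      rw [map_neg, map_add]
    rw [frob_apply, frob_apply, frob_apply, pow_right_comm, hq] at h1
    rw [h1]
    linear_combination (-z * (z ^ 10 + z ^ 5 + 1)) * hz5)
  refine ⟨u, (algebraMap F (AlgebraicClosure F)).injective ?_⟩
  rw [map_pow, map_add, map_one, hu]
  linear_combination hs + (z ^ 3 + 2) * hz5

theorem exists_root_of_unity (h : Fintype.card F % 5 = 1) :
    ∃ z : F, IsPrimitiveRoot z 5 := by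
  obtain ⟨g, hg⟩ := exists_isPrimitiveRoot_card_sub_one F
  have := card_sub_one_pos F
  obtain ⟨k, hk⟩ : 5 ∣ Fintype.card F - 1 := by lia
  exact ⟨g ^ k, hg.pow this (by rw [hk, mul_comm])⟩

end RootsOfUnity

section PrimeDivisors

theorem mod_ten_of_prime_dvd_geomSum {q d : ℕ} (hd : d.Prime) (hd5 : d ≠ 5)
    (h : d ∣ ∑ i ∈ Finset.range 5, q ^ i) : d % 10 = 1 := by
  have : Fact d.Prime := ⟨hd⟩
  have h0 : ∑ i ∈ Finset.range 5, (q : ZMod d) ^ i = 0 := by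
    have := (ZMod.natCast_eq_zero_iff (∑ i ∈ Finset.range 5, q ^ i) d).2 h
    simpa using this
  have h1 : (q : ZMod d) ≠ 1 := by
    intro h1
    have h2 : ((5 : ℕ) : ZMod d) = 0 := by simpa [h1] using h0
    rw [ZMod.natCast_eq_zero_iff, Nat.prime_dvd_prime_iff_eq hd Nat.prime_five] at h2
    exact hd5 h2
  have h5 : (q : ZMod d) ^ 5 = 1 := by
    have := mul_geom_sum (q : ZMod d) 5
    rw [h0, mul_zero] at this
    exact (sub_eq_zero.1 this.symm)
  have hord : orderOf (q : ZMod d) = 5 := by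
    have : Fact (Nat.Prime 5) := ⟨Nat.prime_five⟩
    exact orderOf_eq_prime h5 h1
  have hq0 : (q : ZMod d) ≠ 0 := by
    intro h
    rw [h] at h5
    norm_num at h5
  have hdvd : 5 ∣ d - 1 := hord ▸ ZMod.orderOf_dvd_card_sub_one hq0
  have hodd : d ≠ 2 := by
    rintro rfl
    norm_num at hdvd
  have := hd.eq_two_or_odd
  have := hd.two_le
  lia

theorem not_twentyFive_dvd_geomSum (q : ℕ) : ¬ 25 ∣ ∑ i ∈ Finset.range 5, q ^ i := by
  rw [← ZMod.natCast_eq_zero_iff]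
  push_cast
  generalize (q : ZMod 25) = x
  revert x
  decide +kernel

theorem five_dvd_geomSum_iff (q : ℕ) : 5 ∣ ∑ i ∈ Finset.range 5, q ^ i ↔ q % 5 = 1 := by
  have h : q % 5 = 1 ↔ (q : ZMod 5) = 1 := by
    rw [show (1 : ZMod 5) = ((1 : ℕ) : ZMod 5) by simp, ZMod.natCast_eq_natCast_iff]
    rfl
  rw [h, ← ZMod.natCast_eq_zero_iff]
  push_cast
  generalize (q : ZMod 5) = x
  revert x
  decide +kernel

/-- The prime divisors other than `5` of `1 + q + q ^ 2 + q ^ 3 + q ^ 4`. -/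
def sievePrimes (q : ℕ) : Finset ℕ := (∑ i ∈ Finset.range 5, q ^ i).primeFactors.erase 5

theorem geomSum_ne_zero (q : ℕ) : ∑ i ∈ Finset.range 5, q ^ i ≠ 0 := by
  simp [Finset.sum_range_succ]

theorem mem_sievePrimes {q d : ℕ} :
    d ∈ sievePrimes q ↔ d ≠ 5 ∧ d.Prime ∧ d ∣ ∑ i ∈ Finset.range 5, q ^ i := by
  rw [sievePrimes, Finset.mem_erase, Nat.mem_primeFactors]
  have := geomSum_ne_zero q
  tauto

theorem mod_ten_of_mem_sievePrimes {q d : ℕ} (h : d ∈ sievePrimes q) : d % 10 = 1 := by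
  rw [mem_sievePrimes] at h
  exact mod_ten_of_prime_dvd_geomSum h.2.1 h.1 h.2.2

theorem eleven_le_of_mem_sievePrimes {q d : ℕ} (h : d ∈ sievePrimes q) : 11 ≤ d := by
  have h1 := mod_ten_of_mem_sievePrimes h
  have := (mem_sievePrimes.1 h).2.1.two_le
  lia

theorem prod_sievePrimes_dvd (q : ℕ) :
    ∏ d ∈ sievePrimes q, d ∣ ∑ i ∈ Finset.range 5, q ^ i :=
  (Finset.prod_dvd_prod_of_subset _ _ _ (Finset.erase_subset _ _)).trans
    (Nat.prod_primeFactors_dvd _)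

theorem five_mul_prod_sievePrimes_dvd {q : ℕ} (hq : q % 5 = 1) :
    5 * ∏ d ∈ sievePrimes q, d ∣ ∑ i ∈ Finset.range 5, q ^ i := by
  have h : 5 ∈ (∑ i ∈ Finset.range 5, q ^ i).primeFactors :=
    Nat.mem_primeFactors.2 ⟨Nat.prime_five, (five_dvd_geomSum_iff q).2 hq, geomSum_ne_zero q⟩
  rw [sievePrimes, Finset.mul_prod_erase _ (fun d : ℕ => d) h]
  exact Nat.prod_primeFactors_dvd _

theorem geomSum_le {q : ℕ} (hq : 2 ≤ q) : ∑ i ∈ Finset.range 5, q ^ i ≤ 2 * q ^ 4 := by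
  have h := Nat.geomSum_lt (m := q) (n := 4) (s := Finset.range 4) hq (by simp)
  rw [Finset.sum_range_succ]
  lia

/-- The product of the first `k` integers `> 1` that are congruent to `1` modulo `10`. -/
def prodBound (k : ℕ) : ℕ := ∏ i ∈ Finset.range k, (10 * i + 11)

/-- The sum of the inverses of the first `k` integers `> 1` congruent to `1` modulo `10`. -/
def sumBound (k : ℕ) : ℚ := ∑ i ∈ Finset.range k, 1 / (10 * i + 11 : ℚ)

theorem prodBound_succ (k : ℕ) : prodBound (k + 1) = prodBound k * (10 * k + 11) :=
  Finset.prod_range_succ _ _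

theorem sumBound_succ (k : ℕ) : sumBound (k + 1) = sumBound k + 1 / (10 * k + 11 : ℚ) :=
  Finset.sum_range_succ _ _

theorem sumBound_mono : Monotone sumBound :=
  monotone_nat_of_le_succ fun k => by
    rw [sumBound_succ]
    exact le_add_of_nonneg_right (by positivity)

theorem prodBound_mono : Monotone prodBound :=
  monotone_nat_of_le_succ fun k => by
    rw [prodBound_succ]
    exact Nat.le_mul_of_pos_right _ (by positivity)

theorem bounds_of_mod_ten (P : Finset ℕ) (hP : ∀ d ∈ P, d % 10 = 1 ∧ 11 ≤ d) :
    prodBound P.card ≤ ∏ d ∈ P, d ∧ ∑ d ∈ P, 1 / (d : ℚ) ≤ sumBound P.card := by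
  induction P using Finset.induction_on_max with
  | empty => simp [prodBound, sumBound]
  | insert a s hs ih =>
    have ha : a ∉ s := fun h => lt_irrefl a (hs a h)
    obtain ⟨ih1, ih2⟩ := ih fun d hd => hP d (Finset.mem_insert_of_mem hd)
    have hcard : (insert a s).card ≤ a / 10 := by
      have h := Finset.card_le_card_of_injOn (s := insert a s) (t := Finset.Icc 1 (a / 10))
        (fun d => d / 10) ?_ ?_
      · simpa using h
      · intro d hd
        have h1 := hP d hd
        have h2 : d ≤ a := by
          rcases Finset.mem_insert.1 hd with rfl | hd
          exacts [le_rfl, (hs d hd).le]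
        rw [Finset.mem_coe, Finset.mem_Icc]
        lia
      · intro x hx y hy hxy
        have h1 := hP x hx
        have h2 := hP y hy
        simp only at hxy
        lia
    have hmod := hP a (Finset.mem_insert_self _ _)
    rw [Finset.card_insert_of_notMem ha] at hcard ⊢
    have hle : 10 * s.card + 11 ≤ a := by lia
    rw [Finset.prod_insert ha, Finset.sum_insert ha, prodBound_succ, sumBound_succ]
    constructor
    · rw [mul_comm]
      exact Nat.mul_le_mul hle ih1
    · rw [add_comm]
      refine add_le_add ih2 (one_div_le_one_div_of_le (by positivity) ?_)
      exact_mod_cast hle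

theorem two_mul_pow_le_prodBound {k : ℕ} (h8 : 8 ≤ k) : 2 * (3 * k) ^ 8 ≤ prodBound k := by
  induction k, h8 using Nat.le_induction with
  | base => decide +kernel
  | succ k hk ih =>
    rw [prodBound_succ]
    refine le_trans ?_ (Nat.mul_le_mul ih (show 3 ≤ 10 * k + 11 by lia))
    have h1 : (8 * (k + 1)) ^ 8 ≤ (9 * k) ^ 8 := Nat.pow_le_pow_left (by lia) 8
    rw [mul_pow, mul_pow] at h1
    rw [mul_pow, mul_pow]
    norm_num at h1 ⊢
    lia

theorem mul_pow_le_prodBound {k : ℕ} (hk : 160 ≤ k) : 131072 * 549 ^ k ≤ prodBound k := by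
  induction k, hk using Nat.le_induction with
  | base => decide +kernel
  | succ k hk ih =>
    rw [prodBound_succ, pow_succ, ← mul_assoc]
    exact Nat.mul_le_mul ih (by lia)

theorem sumBound_le : sumBound 160 ≤ 57 / 100 := by
  decide +kernel

end PrimeDivisors

section Estimates

theorem le_sqrt_of_pow_le {q N : ℕ} {t : ℝ} (ht : 2 * t ^ 8 ≤ N) (hN : N ≤ 2 * q ^ 4) :
    t ≤ √q := by
  have h1 : (N : ℝ) ≤ 2 * (q : ℝ) ^ 4 := by exact_mod_cast hN
  have h2 : (√(q : ℝ)) ^ 8 = (q : ℝ) ^ 4 := by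
    rw [show 8 = 2 * 4 by norm_num, pow_mul, Real.sq_sqrt (Nat.cast_nonneg q)]
  refine le_of_pow_le_pow_left₀ (n := 8) (by norm_num) (Real.sqrt_nonneg _) ?_
  rw [h2]
  linarith

theorem linear_estimate {q k : ℕ} {σ t : ℝ} (ht : t ≤ √q) (ht0 : 0 < t) {β : ℝ}
    (hk : 0 ≤ (1 - σ) * t - k) (h : β < ((1 - σ) * t - k) * t) (hσ : σ ≤ 1) :
    k * √q + β < (1 - σ) * q := by
  have h1 : (√(q : ℝ)) ^ 2 = q := Real.sq_sqrt (Nat.cast_nonneg q)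
  have h2 : (1 - σ) * t - k ≤ (1 - σ) * √q - k :=
    sub_le_sub_right (mul_le_mul_of_nonneg_left ht (by linarith)) _
  have h3 : ((1 - σ) * t - k) * t ≤ ((1 - σ) * √q - k) * √q :=
    mul_le_mul h2 ht ht0.le (hk.trans h2)
  nlinarith

theorem linear_estimate_of_five_le {q k : ℕ} (hk : 5 ≤ k) (hk' : k < 160)
    (h : prodBound k ≤ 2 * q ^ 4) : k * √q + 3 < (1 - (sumBound k : ℝ)) * q := by
  rcases lt_or_ge k 8 with h8 | h8
  · have hs5 : sumBound 5 ≤ 215 / 1000 := by decide +kernel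
    have hs7 : sumBound 7 ≤ 25 / 100 := by decide +kernel
    have hs5' : (sumBound 5 : ℝ) ≤ 215 / 1000 := by simpa using (Rat.cast_le (K := ℝ)).2 hs5
    have hs7' : (sumBound 7 : ℝ) ≤ 25 / 100 := by simpa using (Rat.cast_le (K := ℝ)).2 hs7
    have hs6' : (sumBound 6 : ℝ) ≤ 25 / 100 :=
      le_trans (by exact_mod_cast sumBound_mono (by norm_num)) hs7'
    have hp5 : prodBound 5 = 14973651 := by decide +kernel
    have hp6 : prodBound 6 = 913392711 := by decide +kernel
    have hp7 : prodBound 7 = 64850882481 := by decide +kernel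
    interval_cases k
    · have ht := le_sqrt_of_pow_le (t := 7.2) (by rw [hp5]; norm_num) h
      exact linear_estimate ht (by norm_num) (by norm_num; linarith)
        (by norm_num; linarith) (by linarith)
    · have ht := le_sqrt_of_pow_le (t := 12) (by rw [hp6]; norm_num) h
      exact linear_estimate ht (by norm_num) (by norm_num; linarith)
        (by norm_num; linarith) (by linarith)
    · have ht := le_sqrt_of_pow_le (t := 20) (by rw [hp7]; norm_num) h
      exact linear_estimate ht (by norm_num) (by norm_num; linarith)
        (by norm_num; linarith) (by linarith)
  · have ht := le_sqrt_of_pow_le (t := 3 * (k : ℝ))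
      (by exact_mod_cast two_mul_pow_le_prodBound h8) h
    have hs : (sumBound k : ℝ) ≤ 57 / 100 := by
      simpa using (Rat.cast_le (K := ℝ)).2 ((sumBound_mono hk'.le).trans sumBound_le)
    have hk8 : (8 : ℝ) ≤ k := by exact_mod_cast h8
    have h1 : 0.29 * (k : ℝ) ≤ (1 - sumBound k) * (3 * k) - k := by nlinarith
    exact linear_estimate ht (by positivity) (by linarith) (by nlinarith) (by linarith)

variable {F E : Type*} [Field F] [Fintype F] [Field E] [Fintype E] [Algebra F E]

theorem lt_card_sifted_of_linear_estimate (h5 : Module.finrank F E = 5) (V : Submodule F E)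
    (hV : Module.finrank F V = 3) (P : Finset ℕ)
    (hP : ∀ d ∈ P, d ∣ ∑ i ∈ Finset.range 5, Fintype.card F ^ i) {σ β : ℝ} {k B : ℕ}
    (hk : P.card ≤ k) (hσ : ∑ d ∈ P, 1 / (d : ℝ) ≤ σ) (hβ : 1 ≤ β)
    (hB : (B : ℝ) ≤ β * ((Fintype.card F : ℝ) ^ 2 - 1))
    (h : k * √(Fintype.card F) + β < (1 - σ) * Fintype.card F) :
    B < (sifted V P 1).card := by
  have h1 := le_card_sifted_one h5 V hV P hP
  have h2 : ∑ d ∈ P, ((Fintype.card F : ℝ) ^ 3 / d +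
      ((Fintype.card F : ℝ) ^ 2 - 1) * √(Fintype.card F)) =
      (Fintype.card F : ℝ) ^ 3 * ∑ d ∈ P, 1 / (d : ℝ) +
      P.card * (((Fintype.card F : ℝ) ^ 2 - 1) * √(Fintype.card F)) := by
    rw [Finset.sum_add_distrib, Finset.mul_sum, Finset.sum_const, nsmul_eq_mul]
    congr 1
    exact Finset.sum_congr rfl fun d _ => by rw [mul_one_div]
  rw [h2] at h1
  have hk' : (P.card : ℝ) ≤ k := by exact_mod_cast hk
  have hq : (2 : ℝ) ≤ Fintype.card F := by exact_mod_cast (Fintype.one_lt_card (α := F))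
  set q : ℝ := (Fintype.card F : ℝ)
  have hr := Real.sqrt_nonneg q
  have hq2 : 0 < q ^ 2 - 1 := by nlinarith
  have h3 : q ^ 3 * ∑ d ∈ P, 1 / (d : ℝ) ≤ q ^ 3 * σ :=
    mul_le_mul_of_nonneg_left hσ (by positivity)
  have h4 : P.card * ((q ^ 2 - 1) * √q) ≤ k * ((q ^ 2 - 1) * √q) :=
    mul_le_mul_of_nonneg_right hk' (by positivity)
  have h5 := mul_lt_mul_of_pos_right h hq2
  have h6 : 0 ≤ (k : ℝ) * √q := by positivity
  have h7 : 1 ≤ (1 - σ) * q := by linarith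
  have : (B : ℝ) < (sifted V P 1).card := by nlinarith
  exact_mod_cast this

theorem lt_card_sifted_of_many_primes (h5 : Module.finrank F E = 5) (V : Submodule F E)
    (hV : Module.finrank F V = 3) (P : Finset ℕ) (hP : ∀ d ∈ P, d.Prime)
    (hP' : ∀ d ∈ P, d % 10 = 1 ∧ 11 ≤ d)
    (hdvd : ∏ d ∈ P, d ∣ ∑ i ∈ Finset.range 5, Fintype.card F ^ i)
    (hk : 160 ≤ P.card) {B : ℕ} (hB : (B : ℝ) ≤ 3 * ((Fintype.card F : ℝ) ^ 2 - 1)) :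
    B < (sifted V P 1).card := by
  have h1 := (abs_le.1 (abs_card_sifted_sub_le h5 V hV P hP 1 (fun _ _ => Nat.coprime_one_left _)
    (by rwa [one_mul]))).1
  have hq1 : 1 < Fintype.card F := Fintype.one_lt_card
  have hN : prodBound P.card ≤ 2 * Fintype.card F ^ 4 :=
    (bounds_of_mod_ten P hP').1.trans
      ((Nat.le_of_dvd (Nat.pos_of_ne_zero (geomSum_ne_zero _)) hdvd).trans (geomSum_le hq1))
  rw [card_field_mod h5] at h1
  push_cast [Nat.one_le_pow _ _ hq1.le] at h1
  have hq : (2 : ℝ) ≤ Fintype.card F := by exact_mod_cast hq1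
  set k := P.card
  have hr4 : 4 * (11 / 5 : ℝ) ^ k ≤ √(Fintype.card F) := by
    refine le_sqrt_of_pow_le (N := prodBound k) ?_ hN
    have h2 : (131072 : ℝ) * 549 ^ k ≤ prodBound k := by exact_mod_cast mul_pow_le_prodBound hk
    refine le_trans ?_ h2
    rw [mul_pow, pow_right_comm, ← mul_assoc]
    have : ((11 / 5 : ℝ) ^ 8) ^ k ≤ 549 ^ k := pow_le_pow_left₀ (by positivity) (by norm_num) k
    norm_num at this ⊢
    exact this
  have hprod : (10 / 11 : ℝ) ^ k ≤ ∏ d ∈ P, (1 - 1 / (d : ℝ)) := by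
    rw [← Finset.prod_const]
    refine Finset.prod_le_prod (fun _ _ => by norm_num) fun d hd => ?_
    have : (11 : ℝ) ≤ d := by exact_mod_cast (hP' d hd).2
    have := one_div_le_one_div_of_le (by norm_num) this
    linarith
  set q : ℝ := (Fintype.card F : ℝ)
  set r := √q with hr
  have hrr : r ^ 2 = q := Real.sq_sqrt (by positivity)
  have hr0 : 0 ≤ r := Real.sqrt_nonneg _
  have hq2 : 0 < q ^ 2 - 1 := by nlinarith
  have h2k : (1 : ℝ) ≤ 2 ^ k := one_le_pow₀ (by norm_num)
  have h11 : (1 : ℝ) ≤ (11 / 5) ^ k := one_le_pow₀ (by norm_num)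
  have h3 : (q ^ 2 - 1) * q ≤ (q ^ 5 - 1) / q ^ 2 := by
    rw [le_div_iff₀ (by positivity)]
    nlinarith [pow_le_pow_left₀ (by norm_num) hq 3]
  have h4 : 2 ^ k * r + 3 < q * (10 / 11 : ℝ) ^ k := by
    have h5 : (4 : ℝ) * 2 ^ k ≤ r * (10 / 11) ^ k := by
      have := mul_le_mul_of_nonneg_right hr4 (by positivity : (0 : ℝ) ≤ (10 / 11) ^ k)
      rw [mul_assoc, ← mul_pow] at this
      norm_num at this ⊢
      exact this
    have h6 := mul_le_mul_of_nonneg_left h5 hr0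
    have h7 : r ≤ 2 ^ k * r := le_mul_of_one_le_left hr0 h2k
    have h8 : q * (10 / 11 : ℝ) ^ k = r * (r * (10 / 11) ^ k) := by
      rw [← hrr]
      ring
    linarith
  have h5 : (q ^ 2 - 1) * q * (10 / 11 : ℝ) ^ k ≤
      (q ^ 5 - 1) / q ^ 2 / 1 * ∏ d ∈ P, (1 - 1 / (d : ℝ)) := by
    rw [div_one]
    exact mul_le_mul h3 hprod (by positivity) (le_trans (by positivity) h3)
  have h6 := mul_lt_mul_of_pos_left h4 hq2
  have : (B : ℝ) < (sifted V P 1).card := by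
    norm_num at h1 h5
    nlinarith
  exact_mod_cast this

end Estimates

section Existence

variable {F E : Type*} [Field F] [Fintype F] [Field E] [Fintype E] [Algebra F E]

theorem sum_sievePrimes_le {q k : ℕ} (hk : (sievePrimes q).card ≤ k) :
    ∑ d ∈ sievePrimes q, 1 / (d : ℝ) ≤ (sumBound k : ℝ) := by
  have h := (bounds_of_mod_ten (sievePrimes q) fun d hd =>
    ⟨mod_ten_of_mem_sievePrimes hd, eleven_le_of_mem_sievePrimes hd⟩).2.trans (sumBound_mono hk)
  have h' := (Rat.cast_le (K := ℝ)).2 h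
  push_cast at h'
  exact h'

theorem prodBound_le_prod_sievePrimes (q : ℕ) :
    prodBound (sievePrimes q).card ≤ ∏ d ∈ sievePrimes q, d :=
  (bounds_of_mod_ten (sievePrimes q) fun _ hd =>
    ⟨mod_ten_of_mem_sievePrimes hd, eleven_le_of_mem_sievePrimes hd⟩).1

theorem prod_sievePrimes_le (q : ℕ) :
    ∏ d ∈ sievePrimes q, d ≤ ∑ i ∈ Finset.range 5, q ^ i :=
  Nat.le_of_dvd (Nat.pos_of_ne_zero (geomSum_ne_zero q)) (prod_sievePrimes_dvd q)

theorem lt_card_sifted_of_card_le (h5 : Module.finrank F E = 5) (V : Submodule F E)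
    (hV : Module.finrank F V = 3) {k B : ℕ} {s t β : ℚ}
    (hk : (sievePrimes (Fintype.card F)).card ≤ k) (hβ : 1 ≤ β)
    (hB : (B : ℝ) ≤ β * ((Fintype.card F : ℝ) ^ 2 - 1)) (ht0 : 0 < t)
    (ht : (t : ℝ) ^ 2 ≤ Fintype.card F) (hs : sumBound k ≤ s) (hs1 : s ≤ 1)
    (hk' : 0 ≤ (1 - s) * t - k) (h : β < ((1 - s) * t - k) * t) :
    B < (sifted V (sievePrimes (Fintype.card F)) 1).card := by
  refine lt_card_sifted_of_linear_estimate h5 V hV _ (fun d hd => (mem_sievePrimes.1 hd).2.2) hk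
    (σ := s) ((sum_sievePrimes_le hk).trans (Rat.cast_le.2 hs)) (β := β)
    (by exact_mod_cast hβ) hB ?_
  exact linear_estimate (t := t) (Real.le_sqrt_of_sq_le ht) (by exact_mod_cast ht0)
    (by exact_mod_cast hk') (by exact_mod_cast h) (by exact_mod_cast hs1)

theorem lt_card_sifted_of_five_le (h5 : Module.finrank F E = 5) (V : Submodule F E)
    (hV : Module.finrank F V = 3) {B : ℕ} (hB : (B : ℝ) ≤ 3 * ((Fintype.card F : ℝ) ^ 2 - 1))
    (hk : 5 ≤ (sievePrimes (Fintype.card F)).card) :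
    B < (sifted V (sievePrimes (Fintype.card F)) 1).card := by
  rcases lt_or_ge (sievePrimes (Fintype.card F)).card 160 with hk' | hk'
  · refine lt_card_sifted_of_linear_estimate h5 V hV _ (fun d hd => (mem_sievePrimes.1 hd).2.2)
      le_rfl (sum_sievePrimes_le le_rfl) (by norm_num) hB
      (linear_estimate_of_five_le hk hk' ?_)
    exact (prodBound_le_prod_sievePrimes _).trans
      ((prod_sievePrimes_le _).trans (geomSum_le Fintype.one_lt_card))
  · exact lt_card_sifted_of_many_primes h5 V hV _ (fun d hd => (mem_sievePrimes.1 hd).2.1)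
      (fun d hd => ⟨mod_ten_of_mem_sievePrimes hd, eleven_le_of_mem_sievePrimes hd⟩)
      (prod_sievePrimes_dvd _) hk' hB

theorem card_sievePrimes_le {q k N : ℕ} (h : ∏ d ∈ sievePrimes q, d ≤ N)
    (hN : N < prodBound (k + 1)) : (sievePrimes q).card ≤ k := by
  by_contra! hk
  have := (prodBound_mono hk).trans (prodBound_le_prod_sievePrimes q)
  lia

theorem card_sievePrimes_nine : (sievePrimes 9).card ≤ 2 := by
  have h : sievePrimes 9 ⊆ {11, 61} := fun d hd => by
    obtain ⟨-, hp, hdvd⟩ := mem_sievePrimes.1 hd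
    rw [show ∑ i ∈ Finset.range 5, 9 ^ i = 11 ^ 2 * 61 by decide +kernel] at hdvd
    rw [Finset.mem_insert, Finset.mem_singleton]
    rcases hp.dvd_mul.1 hdvd with h | h
    · exact Or.inl ((Nat.prime_dvd_prime_iff_eq hp (by norm_num)).1 (hp.dvd_of_dvd_pow h))
    · exact Or.inr ((Nat.prime_dvd_prime_iff_eq hp (by norm_num)).1 h)
  exact Finset.card_le_card h

theorem card_sievePrimes_twentyFive : (sievePrimes 25).card ≤ 3 := by
  have h : sievePrimes 25 ⊆ {11, 71, 521} := fun d hd => by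
    obtain ⟨-, hp, hdvd⟩ := mem_sievePrimes.1 hd
    rw [show ∑ i ∈ Finset.range 5, 25 ^ i = 11 * 71 * 521 by decide +kernel] at hdvd
    rw [Finset.mem_insert, Finset.mem_insert, Finset.mem_singleton]
    rcases hp.dvd_mul.1 hdvd with h | h
    · rcases hp.dvd_mul.1 h with h | h
      · exact Or.inl ((Nat.prime_dvd_prime_iff_eq hp (by norm_num)).1 h)
      · exact Or.inr (Or.inl ((Nat.prime_dvd_prime_iff_eq hp (by norm_num)).1 h))
    · exact Or.inr (Or.inr ((Nat.prime_dvd_prime_iff_eq hp (by norm_num)).1 h))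
  exact Finset.card_le_card h

theorem card_sievePrimes_eleven : (sievePrimes 11).card ≤ 1 := by
  have h : sievePrimes 11 ⊆ {3221} := fun d hd => by
    obtain ⟨h5, hp, hdvd⟩ := mem_sievePrimes.1 hd
    rw [show ∑ i ∈ Finset.range 5, 11 ^ i = 5 * 3221 by decide +kernel] at hdvd
    rw [Finset.mem_singleton]
    rcases hp.dvd_mul.1 hdvd with h | h
    · exact absurd ((Nat.prime_dvd_prime_iff_eq hp (by norm_num)).1 h) h5
    · exact (Nat.prime_dvd_prime_iff_eq hp (by norm_num)).1 h
  exact Finset.card_le_card h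

theorem lt_card_sifted_of_nine_le (h5 : Module.finrank F E = 5) (V : Submodule F E)
    (hV : Module.finrank F V = 3)
    (hq : Fintype.card F = 9 ∨ Fintype.card F = 19 ∨ Fintype.card F = 25 ∨ 29 ≤ Fintype.card F) :
    (Fintype.card F ^ 2 - 1) + (Fintype.card F ^ 1 - 1) <
      (sifted V (sievePrimes (Fintype.card F)) 1).card := by
  have hq9 : 9 ≤ Fintype.card F := by lia
  have hq9' : (9 : ℝ) ≤ Fintype.card F := by exact_mod_cast hq9
  have hB : (((Fintype.card F ^ 2 - 1) + (Fintype.card F ^ 1 - 1) : ℕ) : ℝ) ≤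
      ((11 / 10 : ℚ) : ℝ) * ((Fintype.card F : ℝ) ^ 2 - 1) := by
    push_cast [Nat.one_le_pow _ _ (Fintype.card_pos (α := F))]
    nlinarith
  have hB' : (((Fintype.card F ^ 2 - 1) + (Fintype.card F ^ 1 - 1) : ℕ) : ℝ) ≤
      3 * ((Fintype.card F : ℝ) ^ 2 - 1) := by
    refine hB.trans (mul_le_mul_of_nonneg_right (by norm_num) ?_)
    nlinarith
  rcases hq with h | h | h | h
  · refine lt_card_sifted_of_card_le h5 V hV (k := 2) (s := 139 / 1000) (t := 3) (β := 11 / 10)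
      (by rw [h]; exact card_sievePrimes_nine) (by norm_num) hB (by norm_num)
      (by rw [h]; norm_num) (by decide +kernel) (by norm_num) (by norm_num) (by norm_num)
  · have hk := card_sievePrimes_le (k := 3) (prod_sievePrimes_le 19) (by decide +kernel)
    refine lt_card_sifted_of_card_le h5 V hV (k := 3) (s := 171 / 1000) (t := 4.35)
      (β := 11 / 10) (by rw [h]; exact hk) (by norm_num) hB (by norm_num)
      (by rw [h]; norm_num) (by decide +kernel) (by norm_num) (by norm_num) (by norm_num)
  · refine lt_card_sifted_of_card_le h5 V hV (k := 3) (s := 171 / 1000) (t := 5) (β := 11 / 10)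
      (by rw [h]; exact card_sievePrimes_twentyFive) (by norm_num) hB (by norm_num)
      (by rw [h]; norm_num) (by decide +kernel) (by norm_num) (by norm_num) (by norm_num)
  · rcases lt_or_ge (sievePrimes (Fintype.card F)).card 5 with hk | hk
    · have h' : (29 : ℝ) ≤ Fintype.card F := by exact_mod_cast h
      refine lt_card_sifted_of_card_le h5 V hV (k := 4) (s := 196 / 1000) (t := 5.38)
        (β := 11 / 10) (Nat.lt_succ_iff.1 hk) (by norm_num) hB (by norm_num)
        (le_trans (by norm_num) h') (by decide +kernel) (by norm_num) (by norm_num) (by norm_num)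
    · exact lt_card_sifted_of_five_le h5 V hV hB' hk

theorem lt_card_sifted_of_mod_five_eq_one (h5 : Module.finrank F E = 5) (V : Submodule F E)
    (hV : Module.finrank F V = 3) (hmod : Fintype.card F % 5 = 1)
    (hq : Fintype.card F = 11 ∨ 31 ≤ Fintype.card F) :
    3 * (Fintype.card F ^ 2 - 1) < (sifted V (sievePrimes (Fintype.card F)) 1).card := by
  have hB : ((3 * (Fintype.card F ^ 2 - 1) : ℕ) : ℝ) ≤ ((3 : ℚ) : ℝ) *
      ((Fintype.card F : ℝ) ^ 2 - 1) := by
    push_cast [Nat.one_le_pow _ _ (Fintype.card_pos (α := F))]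
    exact le_rfl
  rcases hq with h | h
  · refine lt_card_sifted_of_card_le h5 V hV (k := 1) (s := 1 / 11) (t := 3.3)
      (by rw [h]; exact card_sievePrimes_eleven) (by norm_num) hB (by norm_num)
      (by rw [h]; norm_num) (by decide +kernel) (by norm_num) (by norm_num) (by norm_num)
  · rcases lt_or_ge (sievePrimes (Fintype.card F)).card 5 with hk | hk
    · rcases h.eq_or_lt with h31 | h31
      · have hk3 : (sievePrimes (Fintype.card F)).card ≤ 3 := by
          have hd := five_mul_prod_sievePrimes_dvd hmod
          rw [← h31] at hd ⊢
          have := Nat.le_of_dvd (by decide +kernel) hd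
          refine card_sievePrimes_le (N := 190861) ?_ (by decide +kernel)
          have h' : ∑ i ∈ Finset.range 5, 31 ^ i = 5 * 190861 := by decide +kernel
          rw [h'] at this
          lia
        refine lt_card_sifted_of_card_le h5 V hV (k := 3) (s := 171 / 1000) (t := 5.5)
          hk3 (by norm_num) hB (by norm_num)
          (by rw [← h31]; norm_num) (by decide +kernel) (by norm_num) (by norm_num) (by norm_num)
      · have h' : (36 : ℝ) ≤ Fintype.card F := by
          have : 36 ≤ Fintype.card F := by lia
          exact_mod_cast this
        refine lt_card_sifted_of_card_le h5 V hV (k := 4) (s := 196 / 1000) (t := 6)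
          (Nat.lt_succ_iff.1 hk) (by norm_num) hB (by norm_num)
          (le_trans (by norm_num) h') (by decide +kernel) (by norm_num) (by norm_num) (by norm_num)
    · exact lt_card_sifted_of_five_le h5 V hV (by simpa using hB) hk

/-- An element of the kernel of `M` at Frobenius that no cofactor in `S` annihilates and which is
not a `d`-th power for any prime divisor `d ≠ 5` of `(card E - 1) / (card F - 1)`. -/
def HasAdmissibleElement (F E : Type*) [Field F] [Fintype F] [Field E] [Fintype E] [Algebra F E]
    (M : F[X]) (S : Finset F[X]) : Prop :=
  ∃ α : E, aeval (frob F E) M α = 0 ∧ (∀ R ∈ S, aeval (frob F E) R α ≠ 0) ∧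
    ∀ d ∈ sievePrimes (Fintype.card F), α ^ ((Fintype.card E - 1) / d) ≠ 1

theorem IsTwoNormalFactorization.hasAdmissibleElement {M M' : F[X]} {S : Finset F[X]}
    (h : IsTwoNormalFactorization F E M M' S)
    (hlt : ∑ R ∈ S, (Fintype.card F ^ R.natDegree - 1) <
      (sifted (LinearMap.ker (aeval (frob F E) M)) (sievePrimes (Fintype.card F)) 1).card) :
    HasAdmissibleElement F E M S := by
  obtain ⟨α, hα, hα'⟩ := exists_mem_sifted _ _ S h.ne_zero hlt
  obtain ⟨-, hM, hd⟩ := (sifted_one_eq _ _).1 hα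
  exact ⟨α, hM, hα', hd⟩

end Existence

section Necessity

theorem natDegree_ne_two_of_dvd_X_pow_five_sub_one {E : Type*} [Field E] [Fintype E] {p f : ℕ}
    [Fact p.Prime] (hE : Fintype.card E = p ^ f)
    (h : Fintype.card E % 5 = 2 ∨ Fintype.card E % 5 = 3) {D : E[X]} (hD : D ∣ X ^ 5 - 1) :
    D.natDegree ≠ 2 := by
  have hf : f ≠ 0 := by
    rintro rfl
    rw [hE] at h
    norm_num at h
  have hp : p.Coprime 5 := by
    rw [Nat.coprime_primes Fact.out Nat.prime_five]
    rintro rfl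
    have : 5 ∣ Fintype.card E := hE ▸ dvd_pow_self 5 hf
    lia
  have hord : orderOf (ZMod.unitOfCoprime _ (hp.pow_left f)) = 2 ^ (1 + 1) := by
    have h1 : ((ZMod.unitOfCoprime _ (hp.pow_left f) : (ZMod 5)ˣ) : ZMod 5) = 2 ∨
        ((ZMod.unitOfCoprime _ (hp.pow_left f) : (ZMod 5)ˣ) : ZMod 5) = 3 := by
      rw [ZMod.coe_unitOfCoprime, ← hE, show (2 : ZMod 5) = ((2 : ℕ) : ZMod 5) by simp,
        show (3 : ZMod 5) = ((3 : ℕ) : ZMod 5) by simp, ZMod.natCast_eq_natCast_iff,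
        ZMod.natCast_eq_natCast_iff]
      exact h
    generalize ZMod.unitOfCoprime _ (hp.pow_left f) = x at h1
    apply orderOf_eq_prime_pow
    · intro hx
      have := congrArg Units.val hx
      push_cast at this
      rcases h1 with h1 | h1 <;> rw [h1] at this <;> revert this <;> decide
    · apply Units.ext
      push_cast
      rcases h1 with h1 | h1 <;> rw [h1] <;> decide
  have hdeg : (cyclotomic 5 E).natDegree = 4 := by
    rw [natDegree_cyclotomic]
    rfl
  have hirr : Irreducible (cyclotomic 5 E) :=
    irreducible_of_dvd_cyclotomic_of_natDegree hE hp dvd_rfl (by rw [hord, hdeg]; norm_num)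
  have hprod : (X : E[X]) ^ 5 - 1 = cyclotomic 5 E * (X - 1) := by
    have : Fact (Nat.Prime 5) := ⟨Nat.prime_five⟩
    exact (cyclotomic_prime_mul_X_sub_one E 5).symm
  have hX : (X - 1 : E[X]).natDegree = 1 := by
    rw [← C_1, natDegree_X_sub_C]
  have hX0 : (X - 1 : E[X]) ≠ 0 := by simpa using X_sub_C_ne_zero (1 : E)
  have hD0 : D ≠ 0 := by
    rintro rfl
    rw [zero_dvd_iff, hprod] at hD
    exact mul_ne_zero hirr.ne_zero hX0 hD
  intro hD2
  rw [hprod] at hD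
  rcases hirr.isCoprime_or_dvd D with hc | hd
  · have := natDegree_le_of_dvd (hc.symm.dvd_of_dvd_mul_left hD) hX0
    lia
  · have := natDegree_le_of_dvd hd hD0
    lia

theorem mod_five_of_isKNormal_two {q : ℕ} (hq : IsPrimePow q) {E : Type*} [Field E] [Fintype E]
    (hE : Fintype.card E = q ^ 5) {α : E} (h : IsKNormal q 5 2 α) :
    q % 5 = 0 ∨ q % 5 = 1 ∨ q % 5 = 4 := by
  by_contra! hcon
  obtain ⟨p, n, hp, -, rfl⟩ := (isPrimePow_nat_iff _).1 hq
  have : Fact p.Prime := ⟨hp⟩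
  refine natDegree_ne_two_of_dvd_X_pow_five_sub_one (p := p) (f := n * 5)
    (by rw [hE, pow_mul]) ?_ (@EuclideanDomain.gcd_dvd_left _ _ (Classical.decEq _) _ _) h
  rw [hE, Nat.pow_mod]
  have : p ^ n % 5 < 5 := Nat.mod_lt _ (by norm_num)
  have : p ^ n % 5 = 2 ∨ p ^ n % 5 = 3 := by lia
  rcases this with h | h <;> rw [h] <;> norm_num

end Necessity

section Sufficiency

variable {F E : Type*} [Field F] [Fintype F] [Field E] [Fintype E] [Algebra F E]

theorem exists_smul_isPrimitiveElem (h5 : Module.finrank F E = 5) {α : E} (hα : α ≠ 0)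
    (hd : ∀ d : ℕ, d.Prime → d ∣ ∑ i ∈ Finset.range 5, Fintype.card F ^ i →
      α ^ ((Fintype.card E - 1) / d) ≠ 1) :
    ∃ c : F, c ≠ 0 ∧ IsPrimitiveElem (c • α) := by
  obtain ⟨g, hg⟩ := exists_isPrimitiveRoot_card_sub_one E
  have hZ := card_sub_one_pos E
  have : NeZero (Fintype.card E - 1) := ⟨hZ.ne'⟩
  have hZQ := card_sub_one_eq (F := F) (E := E) h5
  obtain ⟨k, -, hk⟩ := hg.eq_pow_of_pow_eq_one (FiniteField.pow_card_sub_one_eq_one α hα)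
  set Q := ∑ i ∈ Finset.range 5, Fintype.card F ^ i with hQ
  have hQZ : Q ∣ Fintype.card E - 1 := hZQ ▸ dvd_mul_left _ _
  have hcop : k.Coprime Q := by
    refine Nat.coprime_of_dvd fun d hdp hdk hdQ => hd d hdp hdQ ?_
    rw [← hk, ← pow_mul, hg.pow_eq_one_iff_dvd]
    obtain ⟨m, rfl⟩ := hdk
    rw [mul_right_comm, Nat.mul_div_cancel' (hdQ.trans hQZ)]
    exact dvd_mul_right _ _
  obtain ⟨u, hu⟩ := ZMod.unitsMap_surjective hQZ (ZMod.unitOfCoprime k hcop)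
  have hu' : ((u : ZMod (Fintype.card E - 1)).val : ZMod Q) = k := by
    have := congrArg Units.val hu
    rw [ZMod.coe_unitOfCoprime] at this
    rw [← this, ZMod.unitsMap_def, Units.coe_map, ZMod.natCast_val]
    rfl
  set k' := (u : ZMod (Fintype.card E - 1)).val with hk'
  have hprim := hg.pow_of_coprime k' (ZMod.val_coe_unit_coprime u)
  have hmod : (g ^ k') ^ (Fintype.card F - 1) = α ^ (Fintype.card F - 1) := by
    rw [← hk, ← pow_mul, ← pow_mul, IsOfFinOrder.pow_eq_pow_iff_modEq
      (hg.isOfFinOrder hZ.ne'), ← hg.eq_orderOf, hZQ, mul_comm k', mul_comm k]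
    exact Nat.ModEq.mul_left' _ ((ZMod.natCast_eq_natCast_iff _ _ _).1 hu')
  have hc1 : (g ^ k' / α) ^ (Fintype.card F - 1) = 1 := by
    rw [div_pow, hmod, div_self (pow_ne_zero _ hα)]
  obtain ⟨c, hc⟩ := mem_range_algebraMap_of_pow_card_eq (F := F) (x := g ^ k' / α) (by
    have h1 : Fintype.card F = Fintype.card F - 1 + 1 := by
      have := Fintype.card_pos (α := F)
      lia
    rw [h1, pow_succ, hc1, one_mul])
  have hcα : c • α = g ^ k' := by
    rw [Algebra.smul_def, hc, div_mul_cancel₀ _ hα]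
  refine ⟨c, ?_, ?_⟩
  · rintro rfl
    rw [zero_smul] at hcα
    exact hprim.ne_zero hZ.ne' hcα.symm
  · rw [hcα]
    exact hprim.eq_orderOf.symm

omit [Fintype F] [Fintype E] in
theorem IsTwoNormalFactorization.nonempty {M M' : F[X]} {S : Finset F[X]}
    (h : IsTwoNormalFactorization F E M M' S) : S.Nonempty := by
  have hdeg : (M.map (algebraMap F E)).natDegree = 3 := by rw [natDegree_map, h.natDegree_left]
  obtain ⟨π, hπ, hd⟩ := exists_irreducible_of_natDegree_ne_zero (f := M.map (algebraMap F E))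
    (by rw [hdeg]; norm_num)
  obtain ⟨R, hR, -⟩ := h.exists_cofactor π hπ hd
  exact ⟨R, hR⟩

theorem IsTwoNormalFactorization.exists_primitive {M M' : F[X]} {S : Finset F[X]}
    (h : IsTwoNormalFactorization F E M M' S) (h5 : Module.finrank F E = 5) {α : E}
    (hα : aeval (frob F E) M α = 0) (hα' : ∀ R ∈ S, aeval (frob F E) R α ≠ 0)
    (hd : ∀ d : ℕ, d.Prime → d ∣ ∑ i ∈ Finset.range 5, Fintype.card F ^ i →
      α ^ ((Fintype.card E - 1) / d) ≠ 1) :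
    ∃ α : E, IsPrimitiveElem α ∧ IsKNormal (Fintype.card F) 5 2 α := by
  obtain ⟨R, hR⟩ := h.nonempty
  have hα0 : α ≠ 0 := by
    rintro rfl
    exact hα' R hR (map_zero _)
  obtain ⟨c, hc, hprim⟩ := exists_smul_isPrimitiveElem h5 hα0 hd
  refine ⟨c • α, hprim, h.isKNormal h5 ?_ fun R hR => ?_⟩
  · rw [LinearMap.map_smul, hα, smul_zero]
  · rw [LinearMap.map_smul]
    exact smul_ne_zero hc (hα' R hR)

theorem IsTwoNormalFactorization.exists_primitive_of_mod_five_ne_one {M M' : F[X]}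
    {S : Finset F[X]} (h : IsTwoNormalFactorization F E M M' S) (h5 : Module.finrank F E = 5)
    (hq : Fintype.card F % 5 ≠ 1) (hadm : HasAdmissibleElement F E M S) :
    ∃ α : E, IsPrimitiveElem α ∧ IsKNormal (Fintype.card F) 5 2 α := by
  obtain ⟨α, hα, hα', hd⟩ := hadm
  refine h.exists_primitive h5 hα hα' fun d hdp hdQ => hd d (mem_sievePrimes.2 ⟨?_, hdp, hdQ⟩)
  rintro rfl
  exact hq ((five_dvd_geomSum_iff _).1 hdQ)

theorem aeval_frob_mul {z : F} {β : E} (hβ : frob F E β = algebraMap F E z * β) (R : F[X])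
    (x : E) : aeval (frob F E) R (β * x) = β * aeval (frob F E) (R.comp (C z * X)) x := by
  have hpow : ∀ (n : ℕ) (x : E),
      (frob F E ^ n) (β * x) = algebraMap F E z ^ n * β * (frob F E ^ n) x := by
    intro n x
    induction n generalizing x with
    | zero => simp
    | succ n ih =>
      have hz : (frob F E ^ n) (algebraMap F E z * β * frob F E x) =
          algebraMap F E z * (frob F E ^ n) (β * frob F E x) := by
        rw [mul_assoc, ← Algebra.smul_def, LinearMap.map_smul, Algebra.smul_def]
      rw [pow_succ, Module.End.mul_apply, frob_mul, hβ, hz, ih, Module.End.mul_apply]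
      ring
  induction R using Polynomial.induction_on' with
  | add p r hp hr => simp only [map_add, LinearMap.add_apply, hp, hr, add_comp, mul_add]
  | monomial n a =>
    rw [← C_mul_X_pow_eq_monomial]
    simp only [mul_comp, C_comp, pow_comp, X_comp, mul_pow, ← C_pow, ← mul_assoc, ← C_mul]
    simp only [map_mul, aeval_C, map_pow, aeval_X, Module.End.mul_apply, hpow,
      Module.algebraMap_end_apply, Algebra.smul_def]
    rw [← map_pow (algebraMap F (E →ₗ[F] E)), Module.algebraMap_end_apply, Algebra.smul_def,
      map_pow]
    ring

theorem exists_primitive_of_splitCubic {z : F} (hz : IsPrimitiveRoot z 5)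
    (h5 : Module.finrank F E = 5) (hq : Fintype.card F % 5 = 1)
    (hadm : HasAdmissibleElement F E (splitCubic 1 z) (splitCofactors 1 z)) :
    ∃ α : E, IsPrimitiveElem α ∧ IsKNormal (Fintype.card F) 5 2 α := by
  have hz5 := hz.pow_eq_one
  have hs : 1 + z + z ^ 2 + z ^ 3 + z ^ 4 = 0 := by
    have := hz.geom_sum_eq_zero (by norm_num)
    simpa [Finset.sum_range_succ] using this
  have hz0 : z ≠ 0 := hz.ne_zero (by norm_num)
  obtain ⟨α, hα, hα', hd⟩ := hadm
  by_cases h : α ^ ((Fintype.card E - 1) / 5) = 1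
  · have hfac : (X - C z) * (X ^ 4 + C z * X ^ 3 + C z ^ 2 * X ^ 2 + C z ^ 3 * X + C z ^ 4) =
        X ^ 5 - 1 := by
      have : C z ^ 5 = 1 := by rw [← C_pow, hz5, C_1]
      linear_combination -this
    have hker := finrank_ker_aeval_frob h5 hfac
    rw [natDegree_X_sub_C] at hker
    have := Module.nontrivial_of_finrank_pos (R := F) (hker ▸ one_pos)
    obtain ⟨⟨β, hβ⟩, hβ0⟩ := exists_ne (0 : LinearMap.ker (aeval (frob F E) (X - C z)))
    replace hβ0 : β ≠ 0 := fun h => hβ0 (Subtype.ext h)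
    replace hβ : frob F E β = algebraMap F E z * β := by
      rw [LinearMap.mem_ker, map_sub, aeval_X, aeval_C, LinearMap.sub_apply,
        Module.algebraMap_end_apply, Algebra.smul_def] at hβ
      exact sub_eq_zero.1 hβ
    have hβq : β ^ (Fintype.card F - 1) = algebraMap F E z := by
      have h1 : Fintype.card F = Fintype.card F - 1 + 1 := by lia
      rw [frob_apply, h1, pow_succ] at hβ
      exact mul_right_cancel₀ hβ0 hβ
    have hβd : ∀ d, d ∣ ∑ i ∈ Finset.range 5, Fintype.card F ^ i →
        β ^ ((Fintype.card E - 1) / d) =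
          algebraMap F E (z ^ ((∑ i ∈ Finset.range 5, Fintype.card F ^ i) / d)) :=
        fun d hd => by
      rw [card_sub_one_div h5 hd, pow_mul, hβq, map_pow]
    have h5Q := (five_dvd_geomSum_iff _).2 hq
    have hcubic : (splitCubic z z).comp (C z * X) = C (z ^ 3) * splitCubic 1 z := by
      simp only [splitCubic, mul_comp, sub_comp, pow_comp, X_comp, C_comp, C_mul, C_pow, C_1]
      ring
    have hcofactors : ∀ R ∈ splitCofactors z z, ∃ R' ∈ splitCofactors 1 z,
        R.comp (C z * X) = C (z ^ 2) * R' := by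
      intro R hR
      simp only [splitCofactors, Finset.mem_insert, Finset.mem_singleton] at hR
      rcases hR with rfl | rfl | rfl
      · refine ⟨(X - C (1 * z)) * (X - C (1 * z ^ 2)), by simp [splitCofactors], ?_⟩
        simp only [mul_comp, sub_comp, pow_comp, X_comp, C_comp, C_mul, C_pow, C_1]
        ring
      · refine ⟨(X - C 1) * (X - C (1 * z ^ 2)), by simp [splitCofactors], ?_⟩
        simp only [mul_comp, sub_comp, pow_comp, X_comp, C_comp, C_mul, C_pow, C_1]
        ring
      · refine ⟨(X - C 1) * (X - C (1 * z)), by simp [splitCofactors], ?_⟩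
        simp only [mul_comp, sub_comp, X_comp, C_comp, C_mul, C_pow, C_1]
        ring
    refine (isTwoNormalFactorization_split (c := z) hz5 hs E).exists_primitive h5 (α := β * α)
      ?_ ?_ ?_
    · rw [aeval_frob_mul hβ, hcubic, map_mul, Module.End.mul_apply, hα, map_zero, mul_zero]
    · intro R hR
      obtain ⟨R', hR', hRR'⟩ := hcofactors R hR
      rw [aeval_frob_mul hβ, hRR', map_mul, Module.End.mul_apply, aeval_C,
        Module.algebraMap_end_apply]
      exact mul_ne_zero hβ0 (smul_ne_zero (pow_ne_zero _ hz0) (hα' R' hR'))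
    · intro d hdp hdQ
      rw [mul_pow, hβd d hdQ]
      by_cases hd5 : d = 5
      · subst hd5
        rw [h, mul_one, Ne, map_eq_one_iff _ (algebraMap F E).injective, hz.pow_eq_one_iff_dvd]
        intro hdvd
        exact not_twentyFive_dvd_geomSum (Fintype.card F)
          (Nat.mul_dvd_of_dvd_div h5Q hdvd)
      · have hdvd : 5 ∣ (∑ i ∈ Finset.range 5, Fintype.card F ^ i) / d := by
          refine Nat.dvd_div_of_mul_dvd ?_
          exact ((Nat.coprime_primes hdp Nat.prime_five).2 hd5).mul_dvd_of_dvd_of_dvd hdQ h5Q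
        rw [(hz.pow_eq_one_iff_dvd _).2 hdvd, map_one, one_mul]
        exact hd d (mem_sievePrimes.2 ⟨hd5, hdp, hdQ⟩)
  · refine (isTwoNormalFactorization_split (c := 1) (one_pow 5) hs E).exists_primitive h5 hα hα'
      fun d hdp hdQ => ?_
    by_cases hd5 : d = 5
    · subst hd5
      exact h
    · exact hd d (mem_sievePrimes.2 ⟨hd5, hdp, hdQ⟩)

end Sufficiency

section CoefficientLists

/-- The value at `β` of the polynomial with coefficient list `l`. -/
def listEval {E : Type*} [Semiring E] (β : E) : List ℕ → E
  | [] => 0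
  | a :: l => a + β * listEval β l

/-- Addition of coefficient lists modulo `p`. -/
def listAdd (p : ℕ) : List ℕ → List ℕ → List ℕ
  | [], m => m
  | a :: l, [] => a :: l
  | a :: l, b :: m => (a + b) % p :: listAdd p l m

/-- Multiplication of a coefficient list by a constant modulo `p`. -/
def listSMul (p a : ℕ) (l : List ℕ) : List ℕ := l.map fun b => a * b % p

/-- Subtraction of coefficient lists modulo `p`. -/
def listSub (p : ℕ) (l m : List ℕ) : List ℕ := listAdd p l (listSMul p (p - 1) m)

/-- The product of polynomials modulo `p`, on coefficient lists. -/
def listPolyMul (p : ℕ) : List ℕ → List ℕ → List ℕ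
  | [], _ => []
  | a :: l, m =>
    if a = 0 then 0 :: listPolyMul p l m
    else listAdd p (listSMul p a m) (0 :: listPolyMul p l m)

/-- One folding step of the reduction modulo `X ^ r - 1`, on coefficient lists. -/
def listFold (p r : ℕ) (l : List ℕ) : List ℕ := listAdd p (l.take r) (l.drop r)

/-- Multiplication modulo `p` and `X ^ r - 1`, on coefficient lists. -/
def listMul (p r : ℕ) (l m : List ℕ) : List ℕ := listFold p r (listPolyMul p l m)

/-- Binary exponentiation modulo `p` and `X ^ r - 1`, for exponents below `2 ^ k`. -/
def listPow (p r : ℕ) : ℕ → List ℕ → ℕ → List ℕ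
  | 0, _, _ => [1]
  | k + 1, l, n =>
    if n % 2 = 0 then listPow p r k (listMul p r l l) (n / 2)
    else listMul p r l (listPow p r k (listMul p r l l) (n / 2))

/-- All coefficients vanish. -/
def listIsZero (l : List ℕ) : Bool := l.all (· == 0)

variable {E : Type*} [CommRing E] {p r : ℕ} {β : E}

theorem listEval_eq_zero_of_listIsZero {l : List ℕ} (h : listIsZero l) : listEval β l = 0 := by
  induction l with
  | nil => rfl
  | cons a l ih =>
    simp only [listIsZero, List.all_cons, Bool.and_eq_true, beq_iff_eq] at h
    rw [listEval, h.1, ih h.2]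
    simp

theorem listEval_listAdd [CharP E p] (l m : List ℕ) :
    listEval β (listAdd p l m) = listEval β l + listEval β m := by
  induction l generalizing m with
  | nil => simp [listAdd, listEval]
  | cons a l ih =>
    cases m with
    | nil => simp [listAdd, listEval]
    | cons b m =>
      simp only [listAdd, listEval, ih, ← CharP.cast_eq_mod E p]
      push_cast
      ring

theorem listEval_listSMul [CharP E p] (a : ℕ) (l : List ℕ) :
    listEval β (listSMul p a l) = a * listEval β l := by
  induction l with
  | nil => simp [listSMul, listEval]
  | cons b l ih =>
    simp only [listSMul, List.map_cons, listEval, ← CharP.cast_eq_mod E p] at ih ⊢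
    rw [ih]
    push_cast
    ring

theorem listEval_listSub [CharP E p] (hp : p ≠ 0) (l m : List ℕ) :
    listEval β (listSub p l m) = listEval β l - listEval β m := by
  rw [listSub, listEval_listAdd, listEval_listSMul, Nat.cast_pred (Nat.pos_of_ne_zero hp),
    CharP.cast_eq_zero]
  ring

theorem listEval_listPolyMul [CharP E p] (l m : List ℕ) :
    listEval β (listPolyMul p l m) = listEval β l * listEval β m := by
  induction l with
  | nil => simp [listPolyMul, listEval]
  | cons a l ih =>
    rw [listPolyMul]
    split_ifs with ha
    · rw [listEval, listEval, ih, ha]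
      ring
    · rw [listEval_listAdd, listEval_listSMul, listEval, listEval, ih]
      push_cast
      ring

theorem listEval_take_add_drop (r : ℕ) (l : List ℕ) :
    listEval β (l.take r) + β ^ r * listEval β (l.drop r) = listEval β l := by
  induction r generalizing l with
  | zero => simp [listEval]
  | succ r ih =>
    cases l with
    | nil => simp [listEval]
    | cons a l =>
      rw [List.take_succ_cons, List.drop_succ_cons, listEval, listEval, ← ih l]
      ring

theorem listEval_listMul [CharP E p] (hβ : β ^ r = 1) (l m : List ℕ) :
    listEval β (listMul p r l m) = listEval β l * listEval β m := by
  rw [listMul, listFold, listEval_listAdd, ← listEval_listPolyMul (p := p),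
    ← listEval_take_add_drop r (listPolyMul p l m), hβ, one_mul]

theorem listEval_listPow [CharP E p] (hβ : β ^ r = 1) {k n : ℕ} (hn : n < 2 ^ k) (l : List ℕ) :
    listEval β (listPow p r k l n) = listEval β l ^ n := by
  induction k generalizing l n with
  | zero =>
    obtain rfl : n = 0 := by simpa using hn
    simp [listPow, listEval]
  | succ k ih =>
    have hn' : n / 2 < 2 ^ k := by
      rw [pow_succ] at hn
      lia
    rw [listPow]
    split_ifs with h
    · rw [ih hn', listEval_listMul hβ, ← sq, ← pow_mul]
      congr 1
      lia
    · rw [listEval_listMul hβ, ih hn', listEval_listMul hβ, ← sq, ← pow_mul, ← pow_succ']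
      congr 1
      lia

/-- A certificate that `l` is invertible modulo `p`, `X ^ r - 1` and `f`: its inverse is `m`, up to
a multiple `h * f`. -/
def listIsInverse (p r : ℕ) (f l m h : List ℕ) : Bool :=
  listIsZero (listSub p (listMul p r l m) (listAdd p [1] (listMul p r f h)))

theorem listEval_ne_zero [CharP E p] [Nontrivial E] (hp : p ≠ 0) (hβ : β ^ r = 1) {f l : List ℕ}
    (hf : listEval β f = 0) (m h : List ℕ) (hc : listIsInverse p r f l m h) :
    listEval β l ≠ 0 := by
  intro hl
  have := listEval_eq_zero_of_listIsZero (β := β) hc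
  rw [listEval_listSub hp, listEval_listMul hβ, listEval_listAdd, listEval_listMul hβ, hf, hl]
    at this
  simp [listEval] at this

theorem listEval_one : listEval β [1] = 1 := by
  simp [listEval]

theorem listEval_pow_ne_one [CharP E p] [Nontrivial E] (hp : p ≠ 0) (hβ : β ^ r = 1)
    {f l : List ℕ} (hf : listEval β f = 0) {n k : ℕ} (hn : n < 2 ^ k) (m h : List ℕ)
    (hc : listIsInverse p r f (listSub p (listPow p r k l n) [1]) m h) :
    listEval β l ^ n ≠ 1 := by
  have := listEval_ne_zero hp hβ hf m h hc
  rwa [listEval_listSub hp, listEval_listPow hβ hn, listEval_one, sub_ne_zero] at this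

end CoefficientLists

section SmallFields

variable {F E : Type*} [Field F] [Fintype F] [Field E] [Algebra F E]

/-- The operator `x ↦ x ^ q - c * x` on coefficient lists. -/
def listFrobSub (p r q : ℕ) (c l : List ℕ) : List ℕ :=
  listSub p (listPow p r 5 l q) (listMul p r c l)

theorem aeval_frob_X_sub_C (z : F) (x : E) :
    aeval (frob F E) (X - C z) x = x ^ Fintype.card F - algebraMap F E z * x := by
  rw [map_sub, aeval_X, aeval_C, LinearMap.sub_apply, Module.algebraMap_end_apply,
    Algebra.smul_def, frob_apply]

theorem aeval_frob_X_sub_one (x : E) :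
    aeval (frob F E) (X - 1 : F[X]) x = x ^ Fintype.card F - 1 * x := by
  rw [← C_1, aeval_frob_X_sub_C, map_one]

theorem aeval_frob_quadratic (u : F) (x : E) : aeval (frob F E) (X ^ 2 + C u * X + 1) x =
    x ^ Fintype.card F ^ 2 + algebraMap F E u * x ^ Fintype.card F + x := by
  simp only [map_add, map_mul, map_pow, map_one, aeval_X, aeval_C, LinearMap.add_apply,
    Module.End.mul_apply, frob_pow_apply, frob_apply, Module.algebraMap_end_apply,
    Algebra.smul_def, Module.End.one_apply]

theorem listEval_listFrobSub {p r q : ℕ} {β : E} [CharP E p] (hp : p ≠ 0) (hβ : β ^ r = 1)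
    (hq : q < 2 ^ 5) (c l : List ℕ) : listEval β (listFrobSub p r q c l) =
      listEval β l ^ q - listEval β c * listEval β l := by
  rw [listFrobSub, listEval_listSub hp, listEval_listPow hβ hq, listEval_listMul hβ]

theorem exists_isPrimitiveRoot_of_dvd [Fintype E] {r : ℕ} (h : r ∣ Fintype.card E - 1) :
    ∃ β : E, IsPrimitiveRoot β r := by
  obtain ⟨g, hg⟩ := exists_isPrimitiveRoot_card_sub_one E
  obtain ⟨k, hk⟩ := h
  exact ⟨g ^ k, hg.pow (card_sub_one_pos E) (by rw [hk, mul_comm])⟩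

theorem IsPrimitiveRoot.listEval_replicate {β : E} {r : ℕ} (hβ : IsPrimitiveRoot β r) (hr : 1 < r) :
    listEval β (List.replicate r 1) = 0 := by
  have h : ∀ n, listEval β (List.replicate n 1) = ∑ i ∈ Finset.range n, β ^ i := fun n => by
    induction n with
    | zero => rfl
    | succ n ih =>
      rw [List.replicate_succ, listEval, ih, Finset.sum_range_succ', Finset.mul_sum, add_comm,
        pow_zero, Nat.cast_one]
      simp only [pow_succ']
  rw [h, hβ.geom_sum_eq_zero hr]

theorem eq_or_eq_of_mem_sievePrimes {q a b d : ℕ} (ha : a.Prime) (hb : b.Prime)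
    (h : ∑ i ∈ Finset.range 5, q ^ i = a * b) (hd : d ∈ sievePrimes q) : d = a ∨ d = b := by
  obtain ⟨-, hdp, hdQ⟩ := mem_sievePrimes.1 hd
  rw [h] at hdQ
  exact (hdp.dvd_mul.1 hdQ).imp (Nat.prime_dvd_prime_iff_eq hdp ha).1
    (Nat.prime_dvd_prime_iff_eq hdp hb).1

variable [Fintype E]

theorem exists_primitive_of_card_eq_five (h5 : Module.finrank F E = 5) (hq : Fintype.card F = 5) :
    ∃ α : E, IsPrimitiveElem α ∧ IsKNormal (Fintype.card F) 5 2 α := by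
  have hE : Fintype.card E = 5 ^ 5 := by rw [card_field_mod h5, hq]
  have : Fact (Nat.Prime 5) := ⟨Nat.prime_five⟩
  have hc : CharP E 5 := charP_of_card_eq_prime_pow hE
  have hF : CharP F 5 := charP_of_card_eq_prime_pow (f := 1) hq
  have h50 : (5 : F) = 0 := by exact_mod_cast CharP.cast_eq_zero F 5
  obtain ⟨β, hβ⟩ := exists_isPrimitiveRoot_of_dvd (E := E) (r := 11) (by rw [hE]; norm_num)
  have hΦ := hβ.listEval_replicate (by norm_num)
  have hβ := hβ.pow_eq_one
  have hp : 5 ≠ 0 := by norm_num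
  have hL : ∀ l, aeval (frob F E) (X - 1 : F[X]) (listEval β l) =
      listEval β (listFrobSub 5 11 5 [1] l) := fun l => by
    rw [aeval_frob_X_sub_one, listEval_listFrobSub hp hβ (by norm_num), listEval_one, hq]
  refine (isTwoNormalFactorization_of_five_eq_zero h50 E).exists_primitive_of_mod_five_ne_one h5
    (by rw [hq]; norm_num) ⟨listEval β [0, 1, 0, 1, 0, 3], ?_, ?_, ?_⟩
  · simp only [pow_succ, pow_zero, one_mul, map_mul, Module.End.mul_apply, hL]
    exact listEval_eq_zero_of_listIsZero (by decide +kernel)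
  · simp only [Finset.mem_singleton, forall_eq, sq, map_mul, Module.End.mul_apply, hL]
    exact listEval_ne_zero hp hβ hΦ [3, 3, 0, 3, 3, 3, 0, 0, 0, 3] [4] (by decide +kernel)
  · rw [hq, hE]
    intro d hd
    rcases eq_or_eq_of_mem_sievePrimes (a := 11) (b := 71) (by norm_num) (by norm_num)
      (by decide) hd with rfl | rfl
    · exact listEval_pow_ne_one (k := 9) hp hβ hΦ (by norm_num)
        [3, 3, 2, 3, 3, 1, 0, 1, 3, 1] [4] (by decide +kernel)
    · exact listEval_pow_ne_one (k := 9) hp hβ hΦ (by norm_num)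
        [0, 4, 1, 1, 1, 4, 3, 0, 1] [4] (by decide +kernel)

theorem exists_primitive_of_card_eq_four (h5 : Module.finrank F E = 5) (hq : Fintype.card F = 4)
    (h50 : (5 : F) ≠ 0) (hroot : ∀ x : E, x ^ 5 = 1 → x = 1) :
    ∃ α : E, IsPrimitiveElem α ∧ IsKNormal (Fintype.card F) 5 2 α := by
  have hE : Fintype.card E = 2 ^ 10 := by
    rw [card_field_mod h5, hq]
    norm_num
  have hc : CharP E 2 := charP_of_card_eq_prime_pow hE
  obtain ⟨β, hβ⟩ := exists_isPrimitiveRoot_of_dvd (E := E) (r := 11) (by rw [hE]; norm_num)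
  have hΦ := hβ.listEval_replicate (by norm_num)
  have hβ := hβ.pow_eq_one
  have hp : 2 ≠ 0 := by norm_num
  obtain ⟨u, hu⟩ := mem_range_algebraMap_of_pow_card_eq (F := F)
    (x := listEval β [0, 1, 0, 1, 1, 1, 0, 0, 0, 1]) (by
      rw [hq, ← listEval_listPow (p := 2) (k := 5) hβ (by norm_num), ← sub_eq_zero,
        ← listEval_listSub (p := 2) hp]
      exact listEval_eq_zero_of_listIsZero (by decide +kernel))
  have hu2 : u ^ 2 = u + 1 := by
    have h := listEval_eq_zero_of_listIsZero (β := β)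
      (l := listSub 2 (listSub 2 (listPow 2 11 5 [0, 1, 0, 1, 1, 1, 0, 0, 0, 1] 2)
        (listAdd 2 [0, 1, 0, 1, 1, 1, 0, 0, 0, 1] [1])) (List.replicate 11 1)) (by decide +kernel)
    rw [listEval_listSub hp, listEval_listSub hp, listEval_listPow hβ (by norm_num),
      listEval_listAdd, listEval_one, hΦ, sub_zero, sub_eq_zero, ← hu] at h
    apply (algebraMap F E).injective
    rw [map_pow, map_add, h, map_one]
  have hL : ∀ l, aeval (frob F E) (X - 1 : F[X]) (listEval β l) =
      listEval β (listFrobSub 2 11 4 [1] l) := fun l => by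
    rw [aeval_frob_X_sub_one, listEval_listFrobSub hp hβ (by norm_num), listEval_one, hq]
  have hQ : ∀ l, aeval (frob F E) (X ^ 2 + C u * X + 1) (listEval β l) =
      listEval β (listAdd 2 (listAdd 2 (listPow 2 11 5 l (4 ^ 2))
        (listMul 2 11 [0, 1, 0, 1, 1, 1, 0, 0, 0, 1] (listPow 2 11 5 l 4))) l) := fun l => by
    rw [aeval_frob_quadratic, listEval_listAdd, listEval_listAdd, listEval_listMul hβ,
      listEval_listPow hβ (by norm_num), listEval_listPow hβ (by norm_num), hu, hq]
  refine (isTwoNormalFactorization_of_golden hu2 h50 E hroot).exists_primitive_of_mod_five_ne_one h5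
    (by rw [hq]; norm_num) ⟨listEval β [0, 1, 1], ?_, ?_, ?_⟩
  · rw [map_mul, Module.End.mul_apply, hQ, hL]
    exact listEval_eq_zero_of_listIsZero (by decide +kernel)
  · simp only [Finset.mem_insert, Finset.mem_singleton, forall_eq_or_imp, forall_eq, hQ, hL]
    exact ⟨listEval_ne_zero hp hβ hΦ [1, 1, 0, 1, 1, 1, 0, 0, 0, 1] [1] (by decide +kernel),
      listEval_ne_zero hp hβ hΦ [0, 0, 1, 0, 1, 1] [1] (by decide +kernel)⟩
  · rw [hq, hE]
    intro d hd
    rcases eq_or_eq_of_mem_sievePrimes (a := 11) (b := 31) (by norm_num) (by norm_num)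
      (by decide) hd with rfl | rfl
    · exact listEval_pow_ne_one (k := 7) hp hβ hΦ (by norm_num)
        [1, 1, 0, 0, 1, 1, 0, 0, 1, 1] [1] (by decide +kernel)
    · exact listEval_pow_ne_one (k := 7) hp hβ hΦ (by norm_num)
        [1, 0, 1, 1, 0, 1, 1, 0, 1, 1] [] (by decide +kernel)

theorem exists_primitive_of_card_eq_sixteen (h5 : Module.finrank F E = 5)
    (hq : Fintype.card F = 16) :
    ∃ α : E, IsPrimitiveElem α ∧ IsKNormal (Fintype.card F) 5 2 α := by
  have hE : Fintype.card E = 2 ^ 20 := by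
    rw [card_field_mod h5, hq]
    norm_num
  have hc : CharP E 2 := charP_of_card_eq_prime_pow hE
  obtain ⟨β, hβ⟩ := exists_isPrimitiveRoot_of_dvd (E := E) (r := 25) (by rw [hE]; norm_num)
  have hΦ : listEval β [1, 0, 0, 0, 0, 1, 0, 0, 0, 0, 1, 0, 0, 0, 0, 1, 0, 0, 0, 0, 1] = 0 := by
    have := (hβ.pow (b := 5) (by norm_num) (show 25 = 5 * 5 by norm_num)).geom_sum_eq_zero
      (by norm_num)
    simp only [Finset.sum_range_succ, Finset.sum_range_zero] at this
    simp only [listEval]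
    push_cast
    linear_combination this
  have hβ15 : IsPrimitiveRoot (β ^ 15) 5 := by
    have := (hβ.pow (b := 5) (by norm_num) (show 25 = 5 * 5 by norm_num)).pow_of_coprime 3
      (by norm_num)
    rwa [← pow_mul] at this
  have hβ := hβ.pow_eq_one
  have hp : 2 ≠ 0 := by norm_num
  obtain ⟨z, hz⟩ := mem_range_algebraMap_of_pow_card_eq (F := F) (x := β ^ 15) (by
    rw [hq, ← pow_mul, show 15 * 16 = 25 * 9 + 15 by norm_num, pow_add, pow_mul, hβ, one_pow,
      one_mul])
  have hz5 : IsPrimitiveRoot z 5 := by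
    rw [← hz] at hβ15
    exact hβ15.of_map_of_injective (algebraMap F E).injective
  have hL : ∀ (k : ℕ) (hk : 15 * k < 2 ^ 5) l, aeval (frob F E) (X - C (1 * z ^ k)) (listEval β l) =
      listEval β (listFrobSub 2 25 16 (listPow 2 25 5 [0, 1] (15 * k)) l) := fun k hk l => by
    rw [aeval_frob_X_sub_C, listEval_listFrobSub hp hβ (by norm_num), listEval_listPow hβ hk, hq,
      one_mul, map_pow, hz, ← pow_mul]
    simp [listEval]
  have hL0 := hL 0 (by norm_num)
  have hL1 := hL 1 (by norm_num)
  have hL2 := hL 2 (by norm_num)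
  rw [pow_zero, one_mul] at hL0
  rw [pow_one] at hL1
  refine exists_primitive_of_splitCubic hz5 h5 (by rw [hq])
    ⟨listEval β [1, 1, 0, 0, 0, 0, 0, 1], ?_, ?_, ?_⟩
  · rw [splitCubic, map_mul, map_mul]
    simp only [Module.End.mul_apply, hL0, hL1, hL2]
    exact listEval_eq_zero_of_listIsZero (by decide +kernel)
  · simp only [splitCofactors, Finset.mem_insert, Finset.mem_singleton, forall_eq_or_imp,
      forall_eq, map_mul (aeval (frob F E)), Module.End.mul_apply, hL0, hL1, hL2]
    exact ⟨listEval_ne_zero hp hβ hΦ [0, 0, 0, 0, 0, 0, 0, 0, 0, 0, 0, 0, 0, 0, 0, 1] [1]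
        (by decide +kernel),
      listEval_ne_zero hp hβ hΦ [0, 0, 0, 0, 1, 0, 0, 0, 0, 1, 0, 0, 0, 0, 0, 0, 0, 0, 0, 1] [1]
        (by decide +kernel),
      listEval_ne_zero hp hβ hΦ [0, 0, 0, 0, 0, 0, 0, 0, 0, 0, 0, 0, 0, 0, 0, 0, 0, 0, 1] [1]
        (by decide +kernel)⟩
  · rw [hq, hE]
    intro d hd
    obtain ⟨hd5, hdp, hdQ⟩ := mem_sievePrimes.1 hd
    rw [show ∑ i ∈ Finset.range 5, 16 ^ i = 5 * 11 * 31 * 41 by decide, hdp.dvd_mul, hdp.dvd_mul,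
      hdp.dvd_mul, Nat.prime_dvd_prime_iff_eq hdp (by norm_num),
      Nat.prime_dvd_prime_iff_eq hdp (by norm_num), Nat.prime_dvd_prime_iff_eq hdp (by norm_num),
      Nat.prime_dvd_prime_iff_eq hdp (by norm_num)] at hdQ
    rcases hdQ with ((rfl | rfl) | rfl) | rfl
    · exact absurd rfl hd5
    · exact listEval_pow_ne_one (k := 17) hp hβ hΦ (by norm_num)
        [1, 0, 0, 0, 0, 0, 0, 0, 0, 1, 1, 0, 1, 1, 0, 1, 1] [1] (by decide +kernel)
    · exact listEval_pow_ne_one (k := 17) hp hβ hΦ (by norm_num)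
        [1, 0, 1, 1, 0, 0, 0, 0, 1, 0, 0, 1, 0, 1, 1, 0, 0, 0, 1] [1] (by decide +kernel)
    · exact listEval_pow_ne_one (k := 17) hp hβ hΦ (by norm_num)
        [1, 1, 0, 0, 1, 1, 0, 1, 1, 0, 1, 0, 1, 1, 1, 0, 1, 1, 1, 1] [1] (by decide +kernel)

end SmallFields

section Classification

variable {F E : Type*} [Field F] [Fintype F] [Field E] [Fintype E] [Algebra F E]

theorem exists_primitive_of_five_eq_zero (h5 : Module.finrank F E = 5) (h50 : (5 : F) = 0)
    (hq : Fintype.card F = 5 ∨ Fintype.card F = 25 ∨ 29 ≤ Fintype.card F) :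
    ∃ α : E, IsPrimitiveElem α ∧ IsKNormal (Fintype.card F) 5 2 α := by
  rcases hq with hq | hq
  · exact exists_primitive_of_card_eq_five h5 hq
  have hf := isTwoNormalFactorization_of_five_eq_zero h50 E
  refine hf.exists_primitive_of_mod_five_ne_one h5
    (by rw [card_mod_five_of_five_eq_zero h50]; norm_num) (hf.hasAdmissibleElement ?_)
  rw [Finset.sum_singleton, natDegree_pow, ← C_1, natDegree_X_sub_C, C_1]
  refine lt_of_le_of_lt (Nat.le_add_right _ (Fintype.card F ^ 1 - 1))
    (lt_card_sifted_of_nine_le h5 _ ?_ (by lia))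
  rw [finrank_ker_aeval_frob h5 hf.mul_eq, hf.natDegree_left]

theorem exists_primitive_of_mod_five_eq_four (h5 : Module.finrank F E = 5)
    (hmod : Fintype.card F % 5 = 4) (hq : Fintype.card F = 4 ∨ Fintype.card F = 9 ∨
      Fintype.card F = 19 ∨ 29 ≤ Fintype.card F) :
    ∃ α : E, IsPrimitiveElem α ∧ IsKNormal (Fintype.card F) 5 2 α := by
  have h50 : (5 : F) ≠ 0 := fun h => by
    have := card_mod_five_of_five_eq_zero h
    lia
  have hroot : ∀ x : E, x ^ 5 = 1 → x = 1 := by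
    intro x hx
    have hx0 : x ≠ 0 := by
      rintro rfl
      norm_num at hx
    have hcop : Nat.gcd 5 (Fintype.card E - 1) = 1 := by
      have hE : Fintype.card E % 5 = 4 := by rw [card_field_mod h5, Nat.pow_mod, hmod]
      rw [← Nat.coprime_iff_gcd_eq_one, Nat.prime_five.coprime_iff_not_dvd]
      lia
    have := pow_gcd_eq_one.2 ⟨hx, FiniteField.pow_card_sub_one_eq_one x hx0⟩
    rwa [hcop, pow_one] at this
  rcases hq with hq | hq
  · exact exists_primitive_of_card_eq_four h5 hq h50 hroot
  classical
  obtain ⟨u, hu⟩ := exists_golden hmod h50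
  have hf := isTwoNormalFactorization_of_golden hu h50 E hroot
  refine hf.exists_primitive_of_mod_five_ne_one h5 (by lia) (hf.hasAdmissibleElement ?_)
  have hdeg : (X ^ 2 + C u * X + 1 : F[X]).natDegree = 2 := by compute_degree!
  have hdeg' : (X - 1 : F[X]).natDegree = 1 := by rw [← C_1, natDegree_X_sub_C]
  rw [Finset.sum_pair (fun h => by rw [h, hdeg'] at hdeg; norm_num at hdeg), hdeg, hdeg']
  refine lt_card_sifted_of_nine_le h5 _ ?_ (by lia)
  rw [finrank_ker_aeval_frob h5 hf.mul_eq, hf.natDegree_left]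

theorem exists_primitive_of_mod_five_eq_one (h5 : Module.finrank F E = 5)
    (hmod : Fintype.card F % 5 = 1) (hq : Fintype.card F = 11 ∨ Fintype.card F = 16 ∨
      31 ≤ Fintype.card F) :
    ∃ α : E, IsPrimitiveElem α ∧ IsKNormal (Fintype.card F) 5 2 α := by
  by_cases h16 : Fintype.card F = 16
  · exact exists_primitive_of_card_eq_sixteen h5 h16
  obtain ⟨z, hz⟩ := exists_root_of_unity hmod
  have hs : 1 + z + z ^ 2 + z ^ 3 + z ^ 4 = 0 := by
    have := hz.geom_sum_eq_zero (by norm_num)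
    simpa [Finset.sum_range_succ] using this
  have hf := isTwoNormalFactorization_split (c := 1) (one_pow 5) hs E
  refine exists_primitive_of_splitCubic hz h5 hmod (hf.hasAdmissibleElement ?_)
  refine lt_of_le_of_lt ?_ (lt_card_sifted_of_mod_five_eq_one h5 _ ?_ hmod (by lia))
  · have hdeg : ∀ R ∈ splitCofactors 1 z, Fintype.card F ^ R.natDegree - 1 ≤
        Fintype.card F ^ 2 - 1 := by
      have h2 : ∀ a b : F, ((X - C a) * (X - C b)).natDegree = 2 := fun a b => by
        rw [natDegree_mul (X_sub_C_ne_zero _) (X_sub_C_ne_zero _), natDegree_X_sub_C,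
          natDegree_X_sub_C]
      intro R hR
      simp only [splitCofactors, Finset.mem_insert, Finset.mem_singleton] at hR
      rcases hR with rfl | rfl | rfl <;> rw [h2]
    refine (Finset.sum_le_card_nsmul _ _ _ hdeg).trans ?_
    rw [smul_eq_mul]
    classical exact Nat.mul_le_mul_right _ Finset.card_le_three
  · rw [finrank_ker_aeval_frob h5 hf.mul_eq, hf.natDegree_left]

theorem exists_subfield_of_card_eq_pow {q n : ℕ} (hq : IsPrimePow q) (E : Type*)
    [Field E] [Fintype E] (hE : Fintype.card E = q ^ n) :
    ∃ (F : Type) (_ : Field F) (_ : Fintype F) (_ : Algebra F E), Fintype.card F = q ∧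
      Module.finrank F E = n := by
  obtain ⟨p, k, hp, hk, rfl⟩ := (isPrimePow_nat_iff _).1 hq
  have : Fact p.Prime := ⟨hp⟩
  have : CharP E p := charP_of_card_eq_prime_pow (f := k * n) (by rw [hE, pow_mul])
  let : Algebra (ZMod p) E := ZMod.algebra E p
  let : Fintype (GaloisField p k) := Fintype.ofFinite _
  have hF : Fintype.card (GaloisField p k) = p ^ k := by
    rw [← Nat.card_eq_fintype_card, GaloisField.card p k hk.ne']
  have hfin : Module.finrank (ZMod p) E = k * n := by
    have := Module.card_eq_pow_finrank (K := ZMod p) (V := E)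
    rw [hE, ZMod.card, ← pow_mul] at this
    exact (Nat.pow_right_injective hp.two_le this).symm
  obtain ⟨f⟩ := FiniteField.nonempty_algHom_of_finrank_dvd (F := ZMod p) (K := GaloisField p k)
    (L := E) (by rw [hfin, GaloisField.finrank p hk.ne']; exact dvd_mul_right _ _)
  let : Algebra (GaloisField p k) E := f.toRingHom.toAlgebra
  refine ⟨GaloisField p k, inferInstance, inferInstance, inferInstance, hF, ?_⟩
  have := Module.card_eq_pow_finrank (K := GaloisField p k) (V := E)
  rw [hE, hF] at this
  exact (Nat.pow_right_injective hq.two_le this).symm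

end Classification

/-- For a prime power `q`, there exists a primitive `2`-normal element in `F_{q^5}`
over `F_q` if and only if `q ≡ 0, 1` or `-1 (mod 5)`. -/
theorem primitive_two_normal_n5 (q : ℕ) (hq : IsPrimePow q)
    (E : Type*) [Field E] [Fintype E] (hE : Fintype.card E = q ^ 5) :
    (∃ α : E, IsPrimitiveElem α ∧ IsKNormal q 5 2 α) ↔
      (q % 5 = 0 ∨ q % 5 = 1 ∨ q % 5 = 4) := by
  refine ⟨fun ⟨_, _, h⟩ => mod_five_of_isKNormal_two hq hE h, fun hmod => ?_⟩
  have hsmall : ∀ m ∈ [0, 1, 6, 10, 14, 15, 20, 21, 24, 26], q ≠ m := by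
    rintro m hm rfl
    have : ∀ m ∈ [0, 1, 6, 10, 14, 15, 20, 21, 24, 26], ¬ IsPrimePow m := by decide +kernel
    exact this q hm hq
  simp only [List.mem_cons, List.not_mem_nil, or_false, forall_eq_or_imp, forall_eq] at hsmall
  obtain ⟨F, _, _, _, rfl, h5⟩ := exists_subfield_of_card_eq_pow hq E hE
  rcases hmod with h | h | h
  · have h50 : (5 : F) = 0 := by
      obtain ⟨p, hp⟩ := CharP.exists F
      obtain ⟨n, hpp, hn⟩ := FiniteField.card F p
      have hd : 5 ∣ p := Nat.prime_five.dvd_of_dvd_pow (hn ▸ Nat.dvd_of_mod_eq_zero h)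
      obtain rfl := (Nat.prime_dvd_prime_iff_eq Nat.prime_five hpp).1 hd
      exact_mod_cast CharP.cast_eq_zero F 5
    exact exists_primitive_of_five_eq_zero h5 h50 (by lia)
  · exact exists_primitive_of_mod_five_eq_one h5 h (by lia)
  · exact exists_primitive_of_mod_five_eq_four h5 h (by lia)

end
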